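/- arXiv:1310.3772 — 3 statements merged into one kernel-verified Lean document; each statement's English description precedes it below -/
import Mathlib

section
/- Let A be a nonempty finite set of positive integers, and let n₁ < n₂ be positive integers with n₁ ∉ A and n₂ ∉ A. Then the Hausdorff dimension of C_{A ∪ {n₁}} is strictly greater than the Hausdorff dimension of C_{A ∪ {n₂}}. -/
open scoped ENNReal

/-- The Gauss map `x ↦ {1/x}`. -/
noncomputable def gaussMap (x : ℝ) : ℝ := Int.fract x⁻¹

/-- The `(n+1)`-st partial quotient of `x`: `a_{n+1}(x) = ⌊1/(T^n x)⌋` where `T` is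
the Gauss map. -/
noncomputable def partialQuot (x : ℝ) (n : ℕ) : ℤ := ⌊(gaussMap^[n] x)⁻¹⌋

/-- The Cantor-like set `C_A` of irrationals in `(0,1)` all of whose partial
quotients lie in `A`. -/
def cfCantorSet (A : Set ℕ) : Set ℝ :=
  { x | Irrational x ∧ x ∈ Set.Ioo (0 : ℝ) 1 ∧
      ∀ n : ℕ, ∃ a ∈ A, partialQuot x n = (a : ℤ) }


/-- The composition of inverse branches of the Gauss map along a word. -/
noncomputable def cfBranch : List ℕ → ℝ → ℝ
  | [], x => x
  | a :: w, x => (a + cfBranch w x)⁻¹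

/-- The denominator of the Möbius map `cfBranch w`, evaluated at a point. -/
noncomputable def cfDenom : List ℕ → ℝ → ℝ
  | [], _ => 1
  | a :: w, x => (a + cfBranch w x) * cfDenom w x

/-- The words of length `n` over the alphabet `B`. -/
def words (B : Finset ℕ) : ℕ → Finset (List ℕ)
  | 0 => {[]}
  | n + 1 => (B ×ˢ words B n).image fun p => p.1 :: p.2

theorem sum_words_succ (B : Finset ℕ) (n : ℕ) (F : List ℕ → ℝ) :
    ∑ w ∈ words B (n + 1), F w = ∑ b ∈ B, ∑ w ∈ words B n, F (b :: w) := by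
  rw [words, Finset.sum_image, Finset.sum_product]
  rintro ⟨a, u⟩ - ⟨b, v⟩ - h
  simpa using h

theorem sum_words_add (B : Finset ℕ) (m n : ℕ) (F : List ℕ → ℝ) :
    ∑ w ∈ words B (m + n), F w = ∑ u ∈ words B m, ∑ v ∈ words B n, F (u ++ v) := by
  induction m generalizing F with
  | zero => simp [words]
  | succ m ih =>
    rw [Nat.add_right_comm, sum_words_succ, sum_words_succ]
    simp [ih]

theorem mem_words {B : Finset ℕ} {n : ℕ} {w : List ℕ} :
    w ∈ words B n ↔ w.length = n ∧ ∀ a ∈ w, a ∈ B := by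
  induction n generalizing w with
  | zero =>
    simp only [words, Finset.mem_singleton, List.length_eq_zero_iff]
    constructor
    · rintro rfl; simp
    · exact And.left
  | succ n ih =>
    cases w with
    | nil => simp [words]
    | cons a w => simp [words, ih]; tauto

theorem card_words (B : Finset ℕ) (n : ℕ) : (words B n).card = B.card ^ n := by
  have h : ((words B n).card : ℝ) = (B.card : ℝ) ^ n := by
    induction n with
    | zero => simp [words]
    | succ n ih =>
      have := sum_words_succ B n fun _ => 1
      simp only [Finset.sum_const, nsmul_eq_mul, mul_one] at this
      rw [this, ih, pow_succ']
  exact_mod_cast h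

theorem cfBranch_append (u v : List ℕ) (x : ℝ) :
    cfBranch (u ++ v) x = cfBranch u (cfBranch v x) := by
  induction u with
  | nil => rfl
  | cons a u ih => simp [cfBranch, ih]

theorem cfDenom_append (u v : List ℕ) (x : ℝ) :
    cfDenom (u ++ v) x = cfDenom u (cfBranch v x) * cfDenom v x := by
  induction u with
  | nil => simp [cfDenom]
  | cons a u ih => simp [cfDenom, ih, cfBranch_append, mul_assoc]

theorem cfBranch_mem_Icc {w : List ℕ} (hw : ∀ a ∈ w, 0 < a) {x : ℝ} (hx : x ∈ Set.Icc (0 : ℝ) 1) :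
    cfBranch w x ∈ Set.Icc (0 : ℝ) 1 := by
  induction w with
  | nil => exact hx
  | cons a w ih =>
    obtain ⟨h0, -⟩ := ih fun b hb => hw b (by simp [hb])
    have ha : (1 : ℝ) ≤ a := by exact_mod_cast hw a (by simp)
    exact ⟨by simp only [cfBranch]; positivity, inv_le_one_of_one_le₀ (by linarith)⟩

/-- The denominator is an affine function of the point. -/
theorem exists_cfDenom_eq {w : List ℕ} (hw : ∀ a ∈ w, 0 < a) :
    ∃ q q' : ℝ, 1 ≤ q ∧ 0 ≤ q' ∧ q' ≤ q ∧ ∀ x, 0 ≤ x → cfDenom w x = q + q' * x := by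
  induction w using List.reverseRecOn with
  | nil => exact ⟨1, 0, le_rfl, le_rfl, zero_le_one, fun x _ => by simp [cfDenom]⟩
  | append_singleton w a ih =>
    obtain ⟨q, q', h1, h2, h3, h⟩ := ih fun b hb => hw b (by simp [hb])
    have ha : (1 : ℝ) ≤ a := by exact_mod_cast hw a (by simp)
    refine ⟨a * q + q', q, by nlinarith, by linarith, by nlinarith, fun x hx => ?_⟩
    have hpos : 0 < (a : ℝ) + x := by linarith
    rw [cfDenom_append]
    simp only [cfBranch, cfDenom]
    rw [h _ (by positivity)]
    field_simp
    ring

theorem one_le_cfDenom {w : List ℕ} (hw : ∀ a ∈ w, 0 < a) {x : ℝ} (hx : 0 ≤ x) :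
    1 ≤ cfDenom w x := by
  obtain ⟨q, q', h1, h2, h3, h⟩ := exists_cfDenom_eq hw
  rw [h x hx]; nlinarith

theorem cfDenom_zero_le {w : List ℕ} (hw : ∀ a ∈ w, 0 < a) {x : ℝ} (hx : 0 ≤ x) :
    cfDenom w 0 ≤ cfDenom w x := by
  obtain ⟨q, q', h1, h2, h3, h⟩ := exists_cfDenom_eq hw
  rw [h x hx, h 0 le_rfl]; nlinarith

theorem cfDenom_le_two_mul {w : List ℕ} (hw : ∀ a ∈ w, 0 < a) {x : ℝ}
    (hx : x ∈ Set.Icc (0 : ℝ) 1) : cfDenom w x ≤ 2 * cfDenom w 0 := by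
  obtain ⟨q, q', h1, h2, h3, h⟩ := exists_cfDenom_eq hw
  rw [h x hx.1, h 0 le_rfl]; nlinarith [hx.1, hx.2]

theorem abs_cfBranch_sub {w : List ℕ} (hw : ∀ a ∈ w, 0 < a) {x y : ℝ}
    (hx : x ∈ Set.Icc (0 : ℝ) 1) (hy : y ∈ Set.Icc (0 : ℝ) 1) :
    |cfBranch w x - cfBranch w y| = |x - y| / (cfDenom w x * cfDenom w y) := by
  induction w with
  | nil => simp [cfBranch, cfDenom]
  | cons a w ih =>
    have hw' : ∀ b ∈ w, 0 < b := fun b hb => hw b (by simp [hb])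
    have ha : (1 : ℝ) ≤ a := by exact_mod_cast hw a (by simp)
    have hX := (cfBranch_mem_Icc hw' hx).1
    have hY := (cfBranch_mem_Icc hw' hy).1
    have h1 : 0 < a + cfBranch w x := by linarith
    have h2 : 0 < a + cfBranch w y := by linarith
    simp only [cfBranch, cfDenom]
    rw [inv_sub_inv h1.ne' h2.ne', abs_div, abs_of_pos (mul_pos h1 h2), abs_sub_comm,
      show a + cfBranch w x - (a + cfBranch w y) = cfBranch w x - cfBranch w y by ring, ih hw',
      div_div]
    ring

theorem two_le_cfDenom {w : List ℕ} (hw : ∀ a ∈ w, 0 < a) (hlen : 2 ≤ w.length) {x : ℝ}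
    (hx : x ∈ Set.Icc (0 : ℝ) 1) : 2 ≤ cfDenom w x := by
  match w, hw, hlen with
  | a :: b :: w, hw, _ =>
    have hw' : ∀ b ∈ w, 0 < b := fun b hb => hw b (by simp [hb])
    have ha : (1 : ℝ) ≤ a := by exact_mod_cast hw a (by simp)
    have hb : (1 : ℝ) ≤ b := by exact_mod_cast hw b (by simp)
    have hX := (cfBranch_mem_Icc hw' hx).1
    have h1 : 0 < b + cfBranch w x := by linarith
    have hd := one_le_cfDenom hw' hx.1
    have : cfDenom (a :: b :: w) x = (a * (b + cfBranch w x) + 1) * cfDenom w x := by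
      simp only [cfBranch, cfDenom]
      field_simp
    rw [this]
    have h2 : 2 ≤ a * (b + cfBranch w x) + 1 := by nlinarith
    nlinarith

/-- The contraction scale of the cylinder of a word: the inverse square of its continuant. -/
noncomputable def cfScale (w : List ℕ) : ℝ := (cfDenom w 0 ^ 2)⁻¹

theorem cfScale_pos {w : List ℕ} (hw : ∀ a ∈ w, 0 < a) : 0 < cfScale w := by
  have := one_le_cfDenom hw le_rfl
  unfold cfScale; positivity

theorem cfScale_le_one {w : List ℕ} (hw : ∀ a ∈ w, 0 < a) : cfScale w ≤ 1 :=
  inv_le_one_of_one_le₀ (one_le_pow₀ (one_le_cfDenom hw le_rfl))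

theorem cfScale_append_le {u v : List ℕ} (hu : ∀ a ∈ u, 0 < a) (hv : ∀ a ∈ v, 0 < a) :
    cfScale (u ++ v) ≤ cfScale u * cfScale v := by
  have h1 := one_le_cfDenom hu le_rfl
  have h2 := one_le_cfDenom hv le_rfl
  have h3 := cfDenom_zero_le hu (cfBranch_mem_Icc hv (x := 0) (by simp)).1
  unfold cfScale
  rw [← mul_inv, ← mul_pow, cfDenom_append]
  gcongr

theorem abs_cfBranch_sub_le {w : List ℕ} (hw : ∀ a ∈ w, 0 < a) {x y : ℝ}
    (hx : x ∈ Set.Icc (0 : ℝ) 1) (hy : y ∈ Set.Icc (0 : ℝ) 1) :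
    |cfBranch w x - cfBranch w y| ≤ cfScale w * |x - y| := by
  have h1 := one_le_cfDenom hw le_rfl
  rw [abs_cfBranch_sub hw hx hy, cfScale, div_eq_inv_mul, sq]
  gcongr
  exacts [zero_le_one.trans (one_le_cfDenom hw hx.1), cfDenom_zero_le hw hx.1,
    cfDenom_zero_le hw hy.1]

theorem le_abs_cfBranch_sub {w : List ℕ} (hw : ∀ a ∈ w, 0 < a) {x y : ℝ}
    (hx : x ∈ Set.Icc (0 : ℝ) 1) (hy : y ∈ Set.Icc (0 : ℝ) 1) :
    cfScale w / 4 * |x - y| ≤ |cfBranch w x - cfBranch w y| := by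
  have h1 := one_le_cfDenom hw hx.1
  have h2 := one_le_cfDenom hw hy.1
  rw [abs_cfBranch_sub hw hx hy, cfScale, div_eq_inv_mul _ (_ * _), div_eq_mul_inv, ← mul_inv,
    show cfDenom w 0 ^ 2 * 4 = (2 * cfDenom w 0) * (2 * cfDenom w 0) by ring]
  gcongr
  exacts [by linarith [cfDenom_le_two_mul hw hx], cfDenom_le_two_mul hw hx,
    cfDenom_le_two_mul hw hy]

/-- The continuant of a word is an affine function of any one of its letters. -/
theorem exists_cfDenom_append_cons_eq {u v : List ℕ} (hu : ∀ a ∈ u, 0 < a) (hv : ∀ a ∈ v, 0 < a) :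
    ∃ q q' y d : ℝ, 1 ≤ q ∧ 0 ≤ q' ∧ q' ≤ q ∧ 0 ≤ y ∧ y ≤ 1 ∧ 1 ≤ d ∧
      ∀ k : ℕ, 0 < k → cfDenom (u ++ k :: v) 0 = (q * (k + y) + q') * d := by
  obtain ⟨q, q', h1, h2, h3, h⟩ := exists_cfDenom_eq hu
  obtain ⟨y0, y1⟩ := cfBranch_mem_Icc hv (x := 0) (by simp)
  refine ⟨q, q', cfBranch v 0, cfDenom v 0, h1, h2, h3, y0, y1, one_le_cfDenom hv le_rfl,
    fun k hk => ?_⟩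
  have hk : (0 : ℝ) < k := by exact_mod_cast hk
  have : 0 < k + cfBranch v 0 := by linarith
  rw [cfDenom_append, h _ (by simp only [cfBranch]; positivity)]
  simp only [cfBranch, cfDenom]
  field_simp

/-- Replacing one letter by a smaller one enlarges the scale by a definite factor. -/
theorem mul_cfScale_le_of_lt {u v : List ℕ} (hu : ∀ a ∈ u, 0 < a) (hv : ∀ a ∈ v, 0 < a) {m n : ℕ}
    (hm : 0 < m) (hmn : m < n) :
    (((n : ℝ) + 2) / (m + 2)) ^ 2 * cfScale (u ++ n :: v) ≤ cfScale (u ++ m :: v) := by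
  obtain ⟨q, q', y, d, h1, h2, h3, y0, y1, hd, key⟩ := exists_cfDenom_append_cons_eq hu hv
  have hm' : (0 : ℝ) < m := by exact_mod_cast hm
  have hmn' : (m : ℝ) < n := by exact_mod_cast hmn
  have hM : 0 < q * (m + y) + q' := by
    have : 0 < q * (m + y) := by apply mul_pos <;> linarith
    linarith
  have hN : 0 < q * (n + y) + q' := by
    have : 0 < q * (n + y) := by apply mul_pos <;> linarith
    linarith
  have hle : (q * (m + y) + q') * ((n : ℝ) + 2) ≤ (q * (n + y) + q') * (m + 2) := by
    have : 0 ≤ (n - m : ℝ) * (q * (2 - y) - q') := by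
      apply mul_nonneg <;> nlinarith
    nlinarith
  unfold cfScale
  rw [key m hm, key n (hm.trans hmn), ← inv_pow, ← inv_pow, ← mul_pow]
  gcongr
  rw [mul_inv, mul_inv, ← mul_assoc]
  gcongr
  rw [div_mul_eq_mul_div, div_le_iff₀ (by positivity), ← div_eq_mul_inv, div_le_iff₀ hN,
    inv_mul_eq_div, div_mul_eq_mul_div, le_div_iff₀ hM]
  linarith

/-- Replacing one letter changes the scale by a bounded factor. -/
theorem mul_cfScale_le {u v : List ℕ} (hu : ∀ a ∈ u, 0 < a) (hv : ∀ a ∈ v, 0 < a) {m n : ℕ}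
    (hm : 0 < m) (hn : 0 < n) :
    (((n : ℝ) + 2) ^ 2)⁻¹ * cfScale (u ++ m :: v) ≤ cfScale (u ++ n :: v) := by
  obtain ⟨q, q', y, d, h1, h2, h3, y0, y1, hd, key⟩ := exists_cfDenom_append_cons_eq hu hv
  have hm' : (1 : ℝ) ≤ m := by exact_mod_cast hm
  have hn' : (1 : ℝ) ≤ n := by exact_mod_cast hn
  have hN : 0 < q * (n + y) + q' := by
    have : 0 < q * (n + y) := by apply mul_pos <;> linarith
    linarith
  unfold cfScale
  rw [← mul_inv, ← mul_pow, key m hm, key n hn, ← mul_assoc]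
  gcongr
  have e1 : q ≤ q * (m + y) := le_mul_of_one_le_right (by linarith) (by linarith)
  have e2 : q * (n + y) ≤ q * (n + 1) := by gcongr
  nlinarith

theorem pos_of_mem_words {B : Finset ℕ} (hB : ∀ b ∈ B, 0 < b) {n : ℕ} {w : List ℕ}
    (hw : w ∈ words B n) : ∀ a ∈ w, 0 < a :=
  fun a ha => hB a ((mem_words.1 hw).2 a ha)

/-- The partition function of the alphabet `B` at level `n` and exponent `s`. -/
noncomputable def partitionSum (B : Finset ℕ) (n : ℕ) (s : ℝ) : ℝ := ∑ w ∈ words B n, cfScale w ^ s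

theorem partitionSum_nonneg {B : Finset ℕ} (hB : ∀ b ∈ B, 0 < b) (n : ℕ) (s : ℝ) :
    0 ≤ partitionSum B n s :=
  Finset.sum_nonneg fun _ hw => Real.rpow_nonneg (cfScale_pos (pos_of_mem_words hB hw)).le _

theorem partitionSum_add_le {B : Finset ℕ} (hB : ∀ b ∈ B, 0 < b) (m n : ℕ) {s : ℝ} (hs : 0 ≤ s) :
    partitionSum B (m + n) s ≤ partitionSum B m s * partitionSum B n s := by
  unfold partitionSum
  rw [sum_words_add, Finset.sum_mul_sum]
  refine Finset.sum_le_sum fun u hu => Finset.sum_le_sum fun v hv => ?_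
  have hu' := pos_of_mem_words hB hu
  have hv' := pos_of_mem_words hB hv
  rw [← Real.mul_rpow (cfScale_pos hu').le (cfScale_pos hv').le]
  refine Real.rpow_le_rpow (cfScale_pos fun a ha => ?_).le (cfScale_append_le hu' hv') hs
  exact (List.mem_append.1 ha).elim (hu' a) (hv' a)

theorem partitionSum_mul_le_pow {B : Finset ℕ} (hB : ∀ b ∈ B, 0 < b) (n k : ℕ) {s : ℝ}
    (hs : 0 ≤ s) : partitionSum B (n * k) s ≤ partitionSum B n s ^ k := by
  induction k with
  | zero => simp [partitionSum, words, cfScale, cfDenom]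
  | succ k ih =>
    rw [Nat.mul_succ, pow_succ]
    exact (partitionSum_add_le hB _ _ hs).trans
      (mul_le_mul_of_nonneg_right ih (partitionSum_nonneg hB n s))

theorem continuous_partitionSum {B : Finset ℕ} (hB : ∀ b ∈ B, 0 < b) (n : ℕ) :
    Continuous (partitionSum B n) :=
  continuous_finsetSum _ fun _ hw =>
    Real.continuous_const_rpow (cfScale_pos (pos_of_mem_words hB hw)).ne'

/-- Exchanging a letter of the alphabet for a smaller new letter increases the sum over that
letter by a definite factor, uniformly in the surrounding word. -/
theorem exists_one_lt_mul_sum_insert_le {A : Finset ℕ} (hA : ∀ a ∈ A, 0 < a) {m n : ℕ} (hm : 0 < m)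
    (hmn : m < n) (hmA : m ∉ A) (hnA : n ∉ A) {s : ℝ} (hs : 0 < s) :
    ∃ ρ : ℝ, 1 < ρ ∧ ∀ u v : List ℕ, (∀ a ∈ u, 0 < a) → (∀ a ∈ v, 0 < a) →
      ρ * ∑ b ∈ insert n A, cfScale (u ++ b :: v) ^ s ≤
        ∑ b ∈ insert m A, cfScale (u ++ b :: v) ^ s := by
  have hn : 0 < n := hm.trans hmn
  set κ : ℝ := (((n : ℝ) + 2) / (m + 2)) ^ 2
  set c : ℝ := (((n : ℝ) + 2) ^ 2)⁻¹
  have hκ1 : 1 < κ := by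
    refine one_lt_pow₀ ?_ two_ne_zero
    rw [one_lt_div (by positivity)]
    have : (m : ℝ) < n := by exact_mod_cast hmn
    linarith
  have ht : 1 < κ ^ s := Real.one_lt_rpow hκ1 hs
  have hc0 : 0 < c ^ s := Real.rpow_pos_of_pos (by positivity) _
  have hN : (0 : ℝ) < (insert n A).card := by
    exact_mod_cast Finset.card_pos.2 (Finset.insert_nonempty n A)
  refine ⟨1 + (κ ^ s - 1) * (c ^ s / (insert n A).card), ?_, fun u v hu hv => ?_⟩
  · have : 0 < (κ ^ s - 1) * (c ^ s / (insert n A).card) :=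
      mul_pos (by linarith) (div_pos hc0 hN)
    linarith
  have hpos : ∀ b : ℕ, 0 < b → 0 < cfScale (u ++ b :: v) := fun b hb => cfScale_pos fun a ha => by
    simp only [List.mem_append, List.mem_cons] at ha
    rcases ha with ha | rfl | ha
    exacts [hu a ha, hb, hv a ha]
  have h1 : κ ^ s * cfScale (u ++ n :: v) ^ s ≤ cfScale (u ++ m :: v) ^ s := by
    rw [← Real.mul_rpow (by positivity) (hpos n hn).le]
    exact Real.rpow_le_rpow (mul_nonneg (by positivity) (hpos n hn).le)
      (mul_cfScale_le_of_lt hu hv hm hmn) hs.le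
  have h2 : c ^ s * ∑ b ∈ insert n A, cfScale (u ++ b :: v) ^ s ≤
      (insert n A).card * cfScale (u ++ n :: v) ^ s := by
    rw [Finset.mul_sum, ← nsmul_eq_mul]
    refine Finset.sum_le_card_nsmul _ _ _ fun b hb => ?_
    have hb : 0 < b := by
      rcases Finset.mem_insert.1 hb with rfl | hb
      exacts [hn, hA b hb]
    rw [← Real.mul_rpow (by positivity) (hpos b hb).le]
    exact Real.rpow_le_rpow (mul_nonneg (by positivity) (hpos b hb).le)
      (mul_cfScale_le hu hv hb hn) hs.le
  have h3 : c ^ s / (insert n A).card * ∑ b ∈ insert n A, cfScale (u ++ b :: v) ^ s ≤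
      cfScale (u ++ n :: v) ^ s := by
    rw [div_mul_eq_mul_div, div_le_iff₀ hN]
    linarith
  have h4 := mul_le_mul_of_nonneg_left h3 (sub_pos.2 ht).le
  rw [add_mul, one_mul, mul_assoc]
  refine (add_le_add_right h4 _).trans ?_
  rw [Finset.sum_insert hnA, Finset.sum_insert hmA]
  linarith

theorem exists_one_lt_pow_mul_partitionSum_le {A : Finset ℕ} (hA : ∀ a ∈ A, 0 < a) {m n : ℕ}
    (hm : 0 < m) (hmn : m < n) (hmA : m ∉ A) (hnA : n ∉ A) {s : ℝ} (hs : 0 < s) :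
    ∃ ρ : ℝ, 1 < ρ ∧ ∀ k : ℕ,
      ρ ^ k * partitionSum (insert n A) k s ≤ partitionSum (insert m A) k s := by
  obtain ⟨ρ, hρ, h⟩ := exists_one_lt_mul_sum_insert_le hA hm hmn hmA hnA hs
  have hpos : ∀ k : ℕ, 0 < k → ∀ b ∈ insert k A, 0 < b := fun k hk b hb => by
    rcases Finset.mem_insert.1 hb with rfl | hb
    exacts [hk, hA b hb]
  have key : ∀ (k : ℕ) (u : List ℕ), (∀ a ∈ u, 0 < a) →
      ρ ^ k * ∑ w ∈ words (insert n A) k, cfScale (u ++ w) ^ s ≤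
        ∑ w ∈ words (insert m A) k, cfScale (u ++ w) ^ s := by
    intro k
    induction k with
    | zero => intro u _; simp [words]
    | succ k ih =>
      intro u hu
      rw [sum_words_succ, sum_words_succ, Finset.sum_comm]
      calc ρ ^ (k + 1) * ∑ w ∈ words (insert n A) k, ∑ b ∈ insert n A, cfScale (u ++ b :: w) ^ s
          = ρ ^ k * ∑ w ∈ words (insert n A) k,
              ρ * ∑ b ∈ insert n A, cfScale (u ++ b :: w) ^ s := by
            rw [← Finset.mul_sum, pow_succ, mul_assoc]
        _ ≤ ρ ^ k * ∑ w ∈ words (insert n A) k, ∑ b ∈ insert m A, cfScale (u ++ b :: w) ^ s := by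
            gcongr with w hw
            exact h u w hu (pos_of_mem_words (hpos n (hm.trans hmn)) hw)
        _ = ∑ b ∈ insert m A, ρ ^ k * ∑ w ∈ words (insert n A) k, cfScale (u ++ b :: w) ^ s := by
            rw [Finset.sum_comm, Finset.mul_sum]
        _ ≤ _ := by
            refine Finset.sum_le_sum fun b hb => ?_
            have := ih (u ++ [b]) fun a ha => by
              rcases List.mem_append.1 ha with ha | ha
              · exact hu a ha
              · rw [List.mem_singleton.1 ha]; exact hpos m hm b hb
            simpa using this
  exact ⟨ρ, hρ, fun k => by simpa [partitionSum] using key k [] (by simp)⟩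

/-- The sets `C_B` are covered by the cylinders of any given level. -/
theorem cfCantorSet_subset_iUnion (B : Finset ℕ) (n : ℕ) :
    cfCantorSet (B : Set ℕ) ⊆ ⋃ w : words B n, cfBranch w.1 '' Set.Icc 0 1 := by
  have key : ∀ x ∈ cfCantorSet (B : Set ℕ), ∃ w ∈ words B n, ∃ y ∈ Set.Icc (0 : ℝ) 1,
      cfBranch w y = x := by
    induction n with
    | zero => exact fun x hx => ⟨[], by simp [words], x, ⟨hx.2.1.1.le, hx.2.1.2.le⟩, rfl⟩
    | succ n ih =>
      rintro x ⟨hirr, hx, hq⟩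
      have hfr : Irrational (gaussMap x) := hirr.inv.sub_intCast _
      have hg : gaussMap x ∈ cfCantorSet (B : Set ℕ) :=
        ⟨hfr, ⟨lt_of_le_of_ne (Int.fract_nonneg _) hfr.ne_zero.symm, Int.fract_lt_one _⟩,
          fun k => hq (k + 1)⟩
      obtain ⟨w, hw, y, hy, hwy⟩ := ih _ hg
      obtain ⟨b, hb, hbx⟩ := hq 0
      refine ⟨b :: w, ?_, y, hy, ?_⟩
      · rw [mem_words] at hw ⊢
        simpa [hw.1] using ⟨hb, hw.2⟩
      · have h1 : (b : ℝ) = (⌊x⁻¹⌋ : ℤ) := by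
          have : ⌊x⁻¹⌋ = (b : ℤ) := hbx
          rw [this]; simp
        rw [cfBranch, hwy, h1, gaussMap, Int.floor_add_fract, inv_inv]
  intro x hx
  obtain ⟨w, hw, y, hy, rfl⟩ := key x hx
  exact Set.mem_iUnion.2 ⟨⟨w, hw⟩, y, hy, rfl⟩

theorem ediam_cfBranch_image_le {w : List ℕ} (hw : ∀ a ∈ w, 0 < a) :
    Metric.ediam (cfBranch w '' Set.Icc 0 1) ≤ ENNReal.ofReal (cfScale w) := by
  refine Metric.ediam_le ?_
  rintro _ ⟨x, hx, rfl⟩ _ ⟨y, hy, rfl⟩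
  rw [edist_dist, Real.dist_eq]
  refine ENNReal.ofReal_le_ofReal ((abs_cfBranch_sub_le hw hx hy).trans ?_)
  refine mul_le_of_le_one_right (cfScale_pos hw).le (abs_le.2 ⟨?_, ?_⟩) <;>
    linarith [hx.1, hx.2, hy.1, hy.2]

open Filter Topology MeasureTheory in
/-- If some partition function is less than one at exponent `s`, then `C_B` has dimension at
most `s`. -/
theorem dimH_cfCantorSet_le {B : Finset ℕ} (hB : ∀ b ∈ B, 0 < b) {n : ℕ} {s : ℝ} (hs : 0 < s)
    (h : partitionSum B n s < 1) : dimH (cfCantorSet (B : Set ℕ)) ≤ ENNReal.ofReal s := by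
  have hZ := partitionSum_nonneg hB n s
  have hpow : Tendsto (fun k : ℕ => partitionSum B n s ^ k) atTop (𝓝 0) :=
    tendsto_pow_atTop_nhds_zero_of_lt_one hZ h
  have hroot : Tendsto (fun k : ℕ => ENNReal.ofReal ((partitionSum B n s ^ k) ^ s⁻¹)) atTop
      (𝓝 0) := by
    have := ENNReal.tendsto_ofReal (hpow.rpow_const (p := s⁻¹) (Or.inr (by positivity)))
    rwa [Real.zero_rpow (by positivity), ENNReal.ofReal_zero] at this
  have hμ := Measure.hausdorffMeasure_le_liminf_sum (X := ℝ) s (cfCantorSet (B : Set ℕ)) _ hroot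
    (fun k (w : words B (n * k)) => cfBranch w.1 '' Set.Icc 0 1)
    (Eventually.of_forall fun k w => by
      have hw := pos_of_mem_words hB w.2
      refine (ediam_cfBranch_image_le hw).trans (ENNReal.ofReal_le_ofReal ?_)
      rw [Real.le_rpow_inv_iff_of_pos (cfScale_pos hw).le (by positivity) hs]
      refine le_trans ?_ (partitionSum_mul_le_pow hB n k hs.le)
      exact Finset.single_le_sum (f := fun w => cfScale w ^ s)
        (fun v hv => Real.rpow_nonneg (cfScale_pos (pos_of_mem_words hB hv)).le _) w.2)
    (Eventually.of_forall fun k => cfCantorSet_subset_iUnion B _)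
  have hle : ∀ k : ℕ, ∑ w : words B (n * k), Metric.ediam (cfBranch w.1 '' Set.Icc 0 1) ^ s ≤
      ENNReal.ofReal (partitionSum B n s ^ k) := fun k => by
    refine le_trans ?_ (ENNReal.ofReal_le_ofReal (partitionSum_mul_le_pow hB n k hs.le))
    rw [partitionSum, ENNReal.ofReal_sum_of_nonneg fun w hw =>
      Real.rpow_nonneg (cfScale_pos (pos_of_mem_words hB hw)).le _,
      ← Finset.sum_coe_sort (words B (n * k))]
    refine Finset.sum_le_sum fun w _ => ?_
    have hw := pos_of_mem_words hB w.2
    rw [← ENNReal.ofReal_rpow_of_pos (cfScale_pos hw)]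
    exact ENNReal.rpow_le_rpow (ediam_cfBranch_image_le hw) hs.le
  have hzero : μH[s] (cfCantorSet (B : Set ℕ)) = 0 := by
    refine le_antisymm (hμ.trans ((liminf_le_liminf (Eventually.of_forall hle)).trans ?_)) bot_le
    have := ENNReal.tendsto_ofReal hpow
    rw [ENNReal.ofReal_zero] at this
    exact this.liminf_eq.le
  have hs' : ((s.toNNReal : NNReal) : ℝ) = s := Real.coe_toNNReal s hs.le
  exact dimH_le_of_hausdorffMeasure_ne_top (d := s.toNNReal) (by rw [hs', hzero]; simp)

open Filter Topology in
/-- A finite family of contractions of an interval has a measurable coding map. -/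
theorem exists_measurable_coding {ι : Type*} [Countable ι] [MeasurableSpace ι]
    [MeasurableSingletonClass ι] {f : ι → ℝ → ℝ} {α β : ℝ} (hαβ : α ≤ β)
    (hmeas : ∀ i, Measurable (f i)) (hmaps : ∀ i, ∀ x ∈ Set.Icc α β, f i x ∈ Set.Icc α β)
    (hf : ∀ i, ∀ x ∈ Set.Icc α β, ∀ y ∈ Set.Icc α β, |f i x - f i y| ≤ 1 / 4 * |x - y|) :
    ∃ π : (ℕ → ι) → ℝ, Measurable π ∧ (∀ ω, π ω ∈ Set.Icc α β) ∧
      ∀ ω, π ω = f (ω 0) (π fun k => ω (k + 1)) := by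
  let c : ℕ → (ℕ → ι) → ℝ := fun n =>
    n.rec (fun _ => α) fun _ g ω => f (ω 0) (g fun k => ω (k + 1))
  have hc : ∀ n ω, c (n + 1) ω = f (ω 0) (c n fun k => ω (k + 1)) := fun _ _ => rfl
  have hmem : ∀ n ω, c n ω ∈ Set.Icc α β := by
    intro n
    induction n with
    | zero => exact fun _ => ⟨le_rfl, hαβ⟩
    | succ n ih => exact fun ω => by rw [hc]; exact hmaps _ _ (ih _)
  have hcm : ∀ n, Measurable (c n) := by
    intro n
    induction n with
    | zero => exact measurable_const
    | succ n ih =>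
      have h1 : Measurable fun p : ι × ℝ => f p.1 p.2 := measurable_from_prod_countable_right hmeas
      have h2 : Measurable fun ω : ℕ → ι => (ω 0, c n fun k => ω (k + 1)) :=
        (measurable_pi_apply 0).prodMk
          (ih.comp (measurable_pi_lambda _ fun k => measurable_pi_apply (k + 1)))
      exact h1.comp h2
  have hdist : ∀ n ω, dist (c n ω) (c (n + 1) ω) ≤ (β - α) * (1 / 4) ^ n := by
    intro n
    induction n with
    | zero =>
      intro ω
      rw [Real.dist_eq, pow_zero, mul_one]
      have h0 := hmem 0 ω
      have h1 := hmem (0 + 1) ω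
      exact abs_le.2 ⟨by linarith [h0.1, h1.2], by linarith [h0.2, h1.1]⟩
    | succ n ih =>
      intro ω
      rw [hc, hc (n + 1), Real.dist_eq]
      have h1 := hf (ω 0) _ (hmem n fun k => ω (k + 1)) _ (hmem (n + 1) fun k => ω (k + 1))
      have h2 := ih fun k => ω (k + 1)
      rw [Real.dist_eq] at h2
      rw [pow_succ]
      linarith
  have hlim : ∀ ω, ∃ l, Tendsto (fun n => c n ω) atTop (𝓝 l) := fun ω =>
    cauchySeq_tendsto_of_complete
      (cauchySeq_of_le_geometric (1 / 4) (β - α) (by norm_num) fun n => hdist n ω)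
  choose π hπ using hlim
  have hπmem : ∀ ω, π ω ∈ Set.Icc α β := fun ω =>
    isClosed_Icc.mem_of_tendsto (hπ ω) (Eventually.of_forall fun n => hmem n ω)
  refine ⟨π, measurable_of_tendsto_metrizable hcm (tendsto_pi_nhds.2 hπ), hπmem, fun ω => ?_⟩
  refine tendsto_nhds_unique ((hπ ω).comp (tendsto_add_atTop_nat 1)) ?_
  rw [tendsto_iff_dist_tendsto_zero]
  have h0 := (tendsto_iff_dist_tendsto_zero.1 (hπ fun k => ω (k + 1))).const_mul (1 / 4)
  rw [mul_zero] at h0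
  exact squeeze_zero (fun _ => dist_nonneg)
    (fun n => hf (ω 0) _ (hmem n fun k => ω (k + 1)) _ (hπmem _)) h0

open MeasureTheory Filter Topology in
/-- A mass distribution principle: a coding map which separates sequences at the scale of their
common cylinder has a range of dimension at least `s` as soon as the scales satisfy
`1 ≤ ∑ i, r i ^ s`. -/
theorem le_dimH_range_of_separated {ι : Type*} [Fintype ι] [MeasurableSpace ι]
    [MeasurableSingletonClass ι] {π : (ℕ → ι) → ℝ} (hπ : Measurable π) {r : ι → ℝ} {c : ℝ}
    (hr : ∀ i, 0 < r i) (hrc : ∀ i, r i ≤ c) (hc : c < 1) {g : ℝ} (hg : 0 < g)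
    (hsep : ∀ ω ω' k, (∀ i < k, ω i = ω' i) → ω k ≠ ω' k →
      g * ∏ i ∈ Finset.range k, r (ω i) ≤ |π ω - π ω'|)
    {s : ℝ} (hs : 0 < s) (hsum : 1 ≤ ∑ i, r i ^ s) :
    ENNReal.ofReal s ≤ dimH (Set.range π) := by
  set S := ∑ i, r i ^ s with hS
  have hS0 : 0 < S := one_pos.trans_le hsum
  have hrs : ∀ i, 0 ≤ r i ^ s := fun i => Real.rpow_nonneg (hr i).le s
  have hp : ∑ i, ENNReal.ofReal (r i ^ s / S) = 1 := by
    rw [← ENNReal.ofReal_sum_of_nonneg fun i _ => div_nonneg (hrs i) hS0.le, ← Finset.sum_div,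
      ← hS, div_self hS0.ne', ENNReal.ofReal_one]
  let P : Measure ι := (PMF.ofFintype _ hp).toMeasure
  have hP : ∀ i, P {i} ≤ ENNReal.ofReal (r i ^ s) := fun i => by
    rw [PMF.toMeasure_apply_singleton _ _ (measurableSet_singleton i), PMF.ofFintype_apply]
    exact ENNReal.ofReal_le_ofReal (div_le_self (hrs i) hsum)
  let μ : Measure (ℕ → ι) := Measure.infinitePi fun _ => P
  have hprod : ∀ (ω : ℕ → ι) (k : ℕ), 0 < ∏ i ∈ Finset.range k, r (ω i) := fun ω k =>
    Finset.prod_pos fun i _ => hr _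
  have hcyl : ∀ (ω : ℕ → ι) (k : ℕ) (E : Set (ℕ → ι)), (∀ ω' ∈ E, ∀ i < k, ω' i = ω i) →
      μ E ≤ ENNReal.ofReal ((∏ i ∈ Finset.range k, r (ω i)) ^ s) := fun ω k E hE => by
    have hsub : E ⊆ Set.pi (Finset.range k) fun i => {ω i} := fun ω' hω' i hi =>
      hE ω' hω' i (by simpa using hi)
    refine (measure_mono hsub).trans ?_
    rw [Measure.infinitePi_pi _ fun i _ => measurableSet_singleton _,
      ← Real.finsetProd_rpow _ _ fun i _ => (hr _).le,
      ENNReal.ofReal_prod_of_nonneg fun i _ => hrs _]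
    exact Finset.prod_le_prod' fun i _ => hP _
  have hmass : ∀ T : Set ℝ, ENNReal.ofReal (g ^ s) * μ (π ⁻¹' T) ≤ Metric.ediam T ^ s := by
    intro T
    by_cases hT : ∃ k, ∃ ω ∈ π ⁻¹' T, ∃ ω' ∈ π ⁻¹' T, ω k ≠ ω' k
    · classical
      obtain ⟨ω, hω, ω', hω', hne⟩ := Nat.find_spec hT
      set k := Nat.find hT
      have hagree : ∀ ω₁ ∈ π ⁻¹' T, ∀ ω₂ ∈ π ⁻¹' T, ∀ i < k, ω₁ i = ω₂ i :=
        fun ω₁ h₁ ω₂ h₂ i hi => by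
          by_contra hcon
          exact Nat.find_min hT hi ⟨ω₁, h₁, ω₂, h₂, hcon⟩
      have h1 := hsep ω ω' k (hagree ω hω ω' hω') hne
      calc ENNReal.ofReal (g ^ s) * μ (π ⁻¹' T)
          ≤ ENNReal.ofReal (g ^ s) * ENNReal.ofReal ((∏ i ∈ Finset.range k, r (ω i)) ^ s) := by
            gcongr
            exact hcyl ω k _ fun ω₁ h₁ => hagree ω₁ h₁ ω hω
        _ = ENNReal.ofReal (g * ∏ i ∈ Finset.range k, r (ω i)) ^ s := by
            rw [← ENNReal.ofReal_mul (by positivity), ← Real.mul_rpow hg.le (hprod ω k).le,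
              ENNReal.ofReal_rpow_of_pos (mul_pos hg (hprod ω k))]
        _ ≤ Metric.ediam T ^ s := by
            refine ENNReal.rpow_le_rpow ((ENNReal.ofReal_le_ofReal h1).trans ?_) hs.le
            rw [← Real.dist_eq, ← edist_dist]
            exact Metric.edist_le_ediam_of_mem hω hω'
    · push Not at hT
      suffices h0 : μ (π ⁻¹' T) = 0 by simp [h0]
      rcases (π ⁻¹' T).eq_empty_or_nonempty with he | ⟨ω, hω⟩
      · rw [he, measure_empty]
      have hc0 : 0 < c := (hr (ω 0)).trans_le (hrc _)
      have hlim : Tendsto (fun k : ℕ => ENNReal.ofReal ((c ^ k) ^ s)) atTop (𝓝 0) := by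
        have := ENNReal.tendsto_ofReal
          ((tendsto_pow_atTop_nhds_zero_of_lt_one hc0.le hc).rpow_const (p := s) (Or.inr hs.le))
        rwa [Real.zero_rpow hs.ne', ENNReal.ofReal_zero] at this
      refine le_antisymm (ge_of_tendsto' hlim fun k => ?_) bot_le
      refine (hcyl ω k _ fun ω' hω' i _ => hT i ω' hω' ω hω).trans (ENNReal.ofReal_le_ofReal ?_)
      refine Real.rpow_le_rpow (hprod ω k).le ?_ hs.le
      exact (Finset.prod_le_prod (fun i _ => (hr _).le) fun i _ => hrc _).trans_eq (by simp)
  have hle : ENNReal.ofReal (g ^ s) • μ.map π ≤ μH[s] := by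
    refine Measure.le_hausdorffMeasure s _ 1 one_pos fun T _ => ?_
    rw [Measure.smul_apply, smul_eq_mul, ← Metric.ediam_closure]
    refine le_trans ?_ (hmass (closure T))
    rw [← Measure.map_apply hπ isClosed_closure.measurableSet]
    gcongr
    exact subset_closure
  have hs' : ((s.toNNReal : NNReal) : ℝ) = s := Real.coe_toNNReal s hs.le
  refine le_dimH_of_hausdorffMeasure_ne_zero (d := s.toNNReal) ?_
  rw [hs']
  refine (lt_of_lt_of_le ?_ (hle (Set.range π))).ne'
  rw [Measure.smul_apply, smul_eq_mul]
  refine ENNReal.mul_pos (by simpa using Real.rpow_pos_of_pos hg s) (ne_of_gt ?_)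
  refine lt_of_lt_of_le ?_ (Measure.le_map_apply hπ.aemeasurable _)
  simp [μ]

theorem measurable_cfBranch (w : List ℕ) : Measurable (cfBranch w) := by
  induction w with
  | nil => exact measurable_id
  | cons a w ih => exact (ih.const_add (a : ℝ)).inv

/-- A set of points of `(0,1)` stable under removing a first partial quotient in `B` consists of
elements of `C_B`. -/
theorem subset_cfCantorSet {B : Set ℕ} {T : Set ℝ} (h01 : T ⊆ Set.Ioo (0 : ℝ) 1)
    (hT : ∀ x ∈ T, ∃ b ∈ B, ∃ y ∈ T, x = (b + y)⁻¹) : T ⊆ cfCantorSet B := by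
  have hgauss : ∀ x ∈ T, ∃ b ∈ B, ⌊x⁻¹⌋ = (b : ℤ) ∧ gaussMap x ∈ T := by
    intro x hx
    obtain ⟨b, hb, y, hy, rfl⟩ := hT x hx
    have h := h01 hy
    refine ⟨b, hb, ?_, ?_⟩
    · rw [inv_inv, Int.floor_natCast_add, Int.floor_eq_zero_iff.2 ⟨h.1.le, h.2⟩, add_zero]
    · rwa [gaussMap, inv_inv, Int.fract_natCast_add, Int.fract_eq_self.2 ⟨h.1.le, h.2⟩]
  have hiter : ∀ x ∈ T, ∀ n, gaussMap^[n] x ∈ T := by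
    intro x hx n
    induction n with
    | zero => exact hx
    | succ n ih =>
      obtain ⟨_, _, _, h⟩ := hgauss _ ih
      rwa [Function.iterate_succ_apply']
  have hrat : ∀ q p : ℕ, (p / q : ℝ) ∉ T := by
    intro q
    induction q using Nat.strong_induction_on with
    | _ q ih =>
      intro p hp
      obtain ⟨h0, h1⟩ := h01 hp
      have hq : (0 : ℝ) < q := by
        rcases Nat.eq_zero_or_pos q with rfl | hq
        · simp at h0
        · exact_mod_cast hq
      have hp0 : (0 : ℝ) < p := by
        by_contra hcon
        have : (p : ℝ) = 0 := le_antisymm (not_lt.1 hcon) p.cast_nonneg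
        simp [this] at h0
      obtain ⟨b, -, y, hy, hxy⟩ := hT _ hp
      have hy0 := (h01 hy).1
      have hyq : y = ((q : ℝ) - b * p) / p := by
        have : (q : ℝ) / p = b + y := by rw [← inv_inv ((b : ℝ) + y), ← hxy, inv_div]
        field_simp at this ⊢
        linarith
      have hbp : b * p ≤ q := by
        have : 0 < (q : ℝ) - b * p := by
          rw [hyq] at hy0
          exact (div_pos_iff_of_pos_right hp0).1 hy0
        have : (b * p : ℝ) ≤ q := by linarith
        exact_mod_cast this
      have hpq : p < q := by
        rw [div_lt_one hq] at h1
        exact_mod_cast h1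
      refine ih p hpq (q - b * p) ?_
      rw [Nat.cast_sub hbp, Nat.cast_mul, ← hyq]
      exact hy
  intro x hx
  refine ⟨?_, h01 hx, fun n => ?_⟩
  · rintro ⟨z, rfl⟩
    have hz : (0 : ℝ) < z := (h01 hx).1
    have hz' : 0 < z := by exact_mod_cast hz
    apply hrat z.den z.num.toNat
    have h1 : ((z.num.toNat : ℕ) : ℝ) = (z.num : ℝ) := by
      exact_mod_cast congrArg (Int.cast (R := ℝ)) (Int.toNat_of_nonneg (Rat.num_pos.2 hz').le)
    rw [h1, ← Rat.cast_def]
    exact hx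
  · obtain ⟨b, hb, h, -⟩ := hgauss _ (hiter x hx n)
    exact ⟨b, hb, h⟩

/-- Branches along distinct words of the same length have images a definite distance apart, on an
interval of length less than one. -/
theorem le_abs_cfBranch_sub_cfBranch {N : ℝ} {α β : ℝ} (hα : 0 < α) (hβ : β < 1) (hN : 0 ≤ N)
    {n : ℕ} {w w' : List ℕ} (hlen : w.length = n) (hlen' : w'.length = n) (hne : w ≠ w')
    (hw : ∀ a ∈ w, 0 < a ∧ (a : ℝ) ≤ N) (hw' : ∀ a ∈ w', 0 < a ∧ (a : ℝ) ≤ N) {x y : ℝ}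
    (hmaps : ∀ v : List ℕ, (∀ a ∈ v, 0 < a ∧ (a : ℝ) ≤ N) → ∀ z ∈ Set.Icc α β,
      cfBranch v z ∈ Set.Icc α β)
    (hx : x ∈ Set.Icc α β) (hy : y ∈ Set.Icc α β) :
    (1 - (β - α)) * (((N + 1) ^ 2)⁻¹) ^ n ≤ |cfBranch w x - cfBranch w' y| := by
  induction n generalizing w w' with
  | zero =>
    rw [List.length_eq_zero_iff] at hlen hlen'
    exact absurd (hlen.trans hlen'.symm) hne
  | succ n ih =>
    match w, w', hlen, hlen' with
    | a :: w, b :: w', hlen, hlen' =>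
      have hwt : ∀ a ∈ w, 0 < a ∧ (a : ℝ) ≤ N := fun c hc => hw c (by simp [hc])
      have hwt' : ∀ a ∈ w', 0 < a ∧ (a : ℝ) ≤ N := fun c hc => hw' c (by simp [hc])
      obtain ⟨ha0, haN⟩ := hw a (by simp)
      obtain ⟨hb0, hbN⟩ := hw' b (by simp)
      have hX := hmaps w hwt x hx
      have hY := hmaps w' hwt' y hy
      have ha0' : (0 : ℝ) < a := by exact_mod_cast ha0
      have hb0' : (0 : ℝ) < b := by exact_mod_cast hb0
      have h1 : 0 < a + cfBranch w x := by linarith [hX.1]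
      have h2 : 0 < b + cfBranch w' y := by linarith [hY.1]
      have hN1 : ((N + 1) ^ 2)⁻¹ ≤ 1 := inv_le_one_of_one_le₀ (one_le_pow₀ (by linarith))
      have hδ : 0 < 1 - (β - α) := by linarith
      have hnum : (1 - (β - α)) * (((N + 1) ^ 2)⁻¹) ^ n ≤
          |b + cfBranch w' y - (a + cfBranch w x)| := by
        rcases eq_or_ne a b with rfl | hab
        · have := ih (by simpa using hlen) (by simpa using hlen') (by simpa using hne) hwt hwt'
          rw [abs_sub_comm] at this
          convert this using 2
          ring
        · have hδ' : (1 - (β - α)) * (((N + 1) ^ 2)⁻¹) ^ n ≤ 1 - (β - α) :=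
            mul_le_of_le_one_right hδ.le (pow_le_one₀ (by positivity) hN1)
          refine hδ'.trans ?_
          rcases lt_or_gt_of_ne hab with h | h
          · have : (a : ℝ) + 1 ≤ b := by exact_mod_cast h
            refine le_trans ?_ (le_abs_self _)
            linarith [hX.2, hY.1]
          · have : (b : ℝ) + 1 ≤ a := by exact_mod_cast h
            refine le_trans ?_ (neg_le_abs _)
            linarith [hX.1, hY.2]
      simp only [cfBranch]
      rw [inv_sub_inv h1.ne' h2.ne', abs_div, abs_of_pos (mul_pos h1 h2), pow_succ, ← mul_assoc,
        div_eq_mul_inv]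
      gcongr
      rw [sq]
      gcongr <;> linarith [hX.2, hY.2]

/-- If the partition function at exponent `s` beats the distortion constant, then `C_B` has
dimension at least `s`. -/
theorem le_dimH_cfCantorSet {B : Finset ℕ} (hB : ∀ b ∈ B, 0 < b) {n : ℕ} (hn : 2 ≤ n) {s : ℝ}
    (hs : 0 < s) (h : 4 ^ s ≤ partitionSum B n s) :
    ENNReal.ofReal s ≤ dimH (cfCantorSet (B : Set ℕ)) := by
  set N : ℝ := ((B.sup id : ℕ) : ℝ) + 1
  have hN1 : 1 ≤ N := le_add_of_nonneg_left (Nat.cast_nonneg _)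
  have hN0 : 0 ≤ N := zero_le_one.trans hN1
  have hBN : ∀ b ∈ B, 0 < b ∧ (b : ℝ) ≤ N := fun b hb =>
    ⟨hB b hb, (Nat.cast_le.2 (Finset.le_sup (f := id) hb)).trans
      (le_add_of_nonneg_right zero_le_one)⟩
  set α : ℝ := (N + 1)⁻¹
  set β : ℝ := (1 + α)⁻¹
  have hα0 : 0 < α := by positivity
  have hα1 : α ≤ 1 := inv_le_one_of_one_le₀ (by linarith)
  have hβ1 : β < 1 := inv_lt_one_of_one_lt₀ (by linarith)
  have hαβ : α ≤ β := inv_anti₀ (by positivity) (by linarith)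
  have hIcc : Set.Icc α β ⊆ Set.Icc 0 1 := Set.Icc_subset_Icc hα0.le hβ1.le
  have hmaps : ∀ v : List ℕ, (∀ a ∈ v, 0 < a ∧ (a : ℝ) ≤ N) → ∀ z ∈ Set.Icc α β,
      cfBranch v z ∈ Set.Icc α β := by
    intro v
    induction v with
    | nil => exact fun _ z hz => hz
    | cons a v ih =>
      intro hv z hz
      obtain ⟨ha, haN⟩ := hv a (by simp)
      have ha : (1 : ℝ) ≤ a := by exact_mod_cast ha
      have hz' := ih (fun b hb => hv b (by simp [hb])) z hz
      exact ⟨inv_anti₀ (by linarith [hz'.1]) (by linarith [hz'.2]),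
        inv_anti₀ (by linarith) (by linarith [hz'.1])⟩
  let _ : MeasurableSpace (words B n) := ⊤
  have hword : ∀ w : words B n, ∀ a ∈ w.1, 0 < a := fun w => pos_of_mem_words hB w.2
  have hword' : ∀ w : words B n, ∀ a ∈ w.1, 0 < a ∧ (a : ℝ) ≤ N := fun w a ha =>
    hBN a ((mem_words.1 w.2).2 a ha)
  have hlen : ∀ w : words B n, w.1.length = n := fun w => (mem_words.1 w.2).1
  have hcontr : ∀ w : words B n, ∀ x ∈ Set.Icc α β, ∀ y ∈ Set.Icc α β,
      |cfBranch w.1 x - cfBranch w.1 y| ≤ 1 / 4 * |x - y| := fun w x hx y hy => by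
    refine (abs_cfBranch_sub_le (hword w) (hIcc hx) (hIcc hy)).trans ?_
    gcongr
    have := two_le_cfDenom (hword w) (by rw [hlen w]; exact hn) (x := 0) (by simp)
    rw [cfScale, one_div]
    exact inv_anti₀ (by norm_num) (by nlinarith)
  obtain ⟨π, hπ, hπmem, hπeq⟩ := exists_measurable_coding hαβ
    (fun w : words B n => measurable_cfBranch w.1) (fun w => hmaps w.1 (hword' w)) hcontr
  have hrange : Set.range π ⊆ cfCantorSet (B : Set ℕ) := by
    have hT : {x | ∃ l : List ℕ, (∀ a ∈ l, a ∈ B) ∧ ∃ ω, x = cfBranch l (π ω)} ⊆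
        cfCantorSet (B : Set ℕ) := by
      refine subset_cfCantorSet ?_ ?_
      · rintro x ⟨l, hl, ω, rfl⟩
        have := hmaps l (fun a ha => hBN a (hl a ha)) _ (hπmem ω)
        exact ⟨hα0.trans_le this.1, this.2.trans_lt hβ1⟩
      · have hcons : ∀ (b : ℕ) (l : List ℕ), (∀ a ∈ b :: l, a ∈ B) → ∀ ω, ∃ b' ∈ (B : Set ℕ),
            ∃ y ∈ {x | ∃ l : List ℕ, (∀ a ∈ l, a ∈ B) ∧ ∃ ω, x = cfBranch l (π ω)},
            cfBranch (b :: l) (π ω) = ((b' : ℕ) + y)⁻¹ := fun b l hl ω =>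
          ⟨b, hl b (by simp), _, ⟨l, fun a ha => hl a (by simp [ha]), ω, rfl⟩, rfl⟩
        rintro x ⟨l, hl, ω, rfl⟩
        cases l with
        | cons b l => exact hcons b l hl ω
        | nil =>
          rw [cfBranch, hπeq]
          have h1 := hlen (ω 0)
          have h2 := (mem_words.1 (ω 0).2).2
          cases hw : (ω 0).1 with
          | nil => rw [hw] at h1; simp at h1; omega
          | cons b l => exact hcons b l (hw ▸ h2) _
    refine Set.Subset.trans ?_ hT
    rintro _ ⟨ω, rfl⟩
    exact ⟨[], by simp, ω, rfl⟩
  refine le_trans ?_ (dimH_mono hrange)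
  have hg : 0 < (1 - (β - α)) * (((N + 1) ^ 2)⁻¹) ^ n := by
    have : 0 < 1 - (β - α) := by linarith
    positivity
  refine le_dimH_range_of_separated hπ (r := fun w : words B n => cfScale w.1 / 4) (c := 1 / 4)
    (fun w => div_pos (cfScale_pos (hword w)) (by norm_num))
    (fun w => by linarith [cfScale_le_one (hword w)]) (by norm_num) hg ?_ hs ?_
  · intro ω ω' k hagree hne
    induction k generalizing ω ω' with
    | zero =>
      rw [Finset.prod_range_zero, mul_one, hπeq ω, hπeq ω']
      exact le_abs_cfBranch_sub_cfBranch hα0 hβ1 hN0 (hlen _) (hlen _)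
        (fun he => hne (Subtype.ext he)) (hword' _) (hword' _) hmaps (hπmem _) (hπmem _)
    | succ k ih =>
      have h1 := ih (fun k => ω (k + 1)) (fun k => ω' (k + 1))
        (fun i hi => hagree (i + 1) (by omega)) hne
      rw [hπeq ω, hπeq ω', ← hagree 0 (by omega), Finset.prod_range_succ', ← mul_assoc, mul_comm]
      refine le_trans ?_ (le_abs_cfBranch_sub (hword (ω 0)) (hIcc (hπmem _)) (hIcc (hπmem _)))
      have := cfScale_pos (hword (ω 0))
      gcongr
  · rw [Finset.sum_coe_sort (words B n) fun w => (cfScale w / 4) ^ s]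
    have : ∑ w ∈ words B n, (cfScale w / 4) ^ s = partitionSum B n s / 4 ^ s := by
      rw [partitionSum, Finset.sum_div]
      exact Finset.sum_congr rfl fun w hw =>
        Real.div_rpow (cfScale_pos (pos_of_mem_words hB hw)).le (by norm_num) _
    rw [this, one_le_div (by positivity)]
    exact h

open Filter Topology in
/-- If the partition function at exponent `s` strictly beats the distortion constant, then `C_B`
has dimension greater than `s`. -/
theorem lt_dimH_cfCantorSet {B : Finset ℕ} (hB : ∀ b ∈ B, 0 < b) {n : ℕ} (hn : 2 ≤ n) {s : ℝ}
    (hs : 0 ≤ s) (h : 4 ^ s < partitionSum B n s) :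
    ENNReal.ofReal s < dimH (cfCantorSet (B : Set ℕ)) := by
  have hev : ∀ᶠ t in 𝓝 s, (4 : ℝ) ^ t < partitionSum B n t :=
    (Real.continuous_const_rpow (by norm_num)).continuousAt.eventually_lt
      (continuous_partitionSum hB n).continuousAt h
  obtain ⟨t, ht, hst⟩ := ((hev.filter_mono nhdsWithin_le_nhds).and
    (self_mem_nhdsWithin (a := s) (s := Set.Ioi s))).exists
  have ht0 : 0 < t := hs.trans_lt hst
  exact ((ENNReal.ofReal_lt_ofReal_iff ht0).2 hst).trans_le (le_dimH_cfCantorSet hB hn ht0 ht.le)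

open Filter Topology in
/-- At the dimension of `C_B`, no partition function is less than one. -/
theorem one_le_partitionSum_of_dimH_eq {B : Finset ℕ} (hB : ∀ b ∈ B, 0 < b) (n : ℕ) {s : ℝ}
    (hs : 0 < s) (h : dimH (cfCantorSet (B : Set ℕ)) = ENNReal.ofReal s) :
    1 ≤ partitionSum B n s := by
  by_contra! hlt
  have hev : ∀ᶠ t in 𝓝 s, partitionSum B n t < 1 :=
    (continuous_partitionSum hB n).continuousAt.eventually_lt continuousAt_const hlt
  obtain ⟨t, ⟨ht, ht0⟩, hts⟩ := (((hev.and (lt_mem_nhds hs)).filter_mono nhdsWithin_le_nhds).and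
    (self_mem_nhdsWithin (a := s) (s := Set.Iio s))).exists
  have := dimH_cfCantorSet_le hB ht0 ht
  rw [h] at this
  exact this.not_gt ((ENNReal.ofReal_lt_ofReal_iff hs).2 hts)

/-- Augmenting an alphabet by a smaller new letter gives strictly larger
Hausdorff dimension than augmenting by a larger one. -/
theorem dimH_augment_strict_mono (A : Finset ℕ) (hne : A.Nonempty)
    (hA : ∀ a ∈ A, 0 < a) (n₁ n₂ : ℕ) (hn₁ : 0 < n₁) (hlt : n₁ < n₂)
    (h₁ : n₁ ∉ A) (h₂ : n₂ ∉ A) :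
    dimH (cfCantorSet (insert n₁ (↑A : Set ℕ))) >
      dimH (cfCantorSet (insert n₂ (↑A : Set ℕ))) := by
  have hpos : ∀ k : ℕ, 0 < k → ∀ b ∈ insert k A, 0 < b := fun k hk b hb => by
    rcases Finset.mem_insert.1 hb with rfl | hb
    exacts [hk, hA b hb]
  rw [← Finset.coe_insert, ← Finset.coe_insert, gt_iff_lt]
  set d := dimH (cfCantorSet ((insert n₂ A : Finset ℕ) : Set ℕ)) with hd
  have hdtop : d ≠ ⊤ := Real.dimH_ne_top _
  rw [← ENNReal.ofReal_toReal hdtop]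
  rcases (ENNReal.toReal_nonneg (a := d)).eq_or_lt with h0 | h0
  · rw [← h0]
    refine lt_dimH_cfCantorSet (hpos n₁ hn₁) le_rfl le_rfl ?_
    have hcard : 2 ≤ (insert n₁ A).card := by
      rw [Finset.card_insert_of_notMem h₁]
      have := hne.card_pos
      omega
    have : (2 : ℝ) ≤ (insert n₁ A).card := by exact_mod_cast hcard
    simp only [partitionSum, Real.rpow_zero, Finset.sum_const, card_words, nsmul_eq_mul, mul_one]
    push_cast
    nlinarith
  · obtain ⟨ρ, hρ, hgrow⟩ := exists_one_lt_pow_mul_partitionSum_le hA hn₁ hlt h₁ h₂ h0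
    obtain ⟨k, hk⟩ := pow_unbounded_of_one_lt (4 ^ d.toReal) hρ
    have hk' : 4 ^ d.toReal < ρ ^ (k + 2) :=
      hk.trans_le (pow_le_pow_right₀ hρ.le (by omega))
    refine lt_dimH_cfCantorSet (hpos n₁ hn₁) (n := k + 2) (by omega) h0.le (hk'.trans_le ?_)
    refine le_trans ?_ (hgrow (k + 2))
    exact le_mul_of_one_le_right (by positivity)
      (one_le_partitionSum_of_dimH_eq (hpos n₂ (hn₁.trans hlt)) _ h0
        (ENNReal.ofReal_toReal hdtop).symm)
end

section
/- Let A_odd = {1, 3, 5, 7, …} be the set of all odd positive integers. Then: (i) the reduction modulo 2 of Γ_{A_odd} is a proper subset of SL₂(ℤ/2ℤ), so Γ_{A_odd} does not have everywhere strong approximation; and (ii) for every nonempty set A of positive integers such that Γ_A does not have everywhere strong approximation, δ_A ≤ δ_{A_odd}. That is, among all alphabets whose determinant-one semigroup fails everywhere strong approximation, the odd numbers have the largest Hausdorff dimension. -/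
open scoped ENNReal

/-- The generator matrix `[[0,1],[1,a]]`. -/
def cfGen (a : ℕ) : Matrix (Fin 2) (Fin 2) ℤ := !![0, 1; 1, (a : ℤ)]

/-- The determinant-one semigroup `Γ_A`: all nonempty finite products of the
generators `[[0,1],[1,a]]·[[0,1],[1,a']]` with `a, a' ∈ A`. -/
def GammaSemigroup (A : Set ℕ) : Set (Matrix (Fin 2) (Fin 2) ℤ) :=
  { M | ∃ l : List (ℕ × ℕ), l ≠ [] ∧ (∀ p ∈ l, p.1 ∈ A ∧ p.2 ∈ A) ∧
      M = (l.map (fun p => cfGen p.1 * cfGen p.2)).prod }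

/-- `Γ_A` has everywhere strong approximation if for every `q ≥ 2` its reduction
mod `q` is all of `SL₂(ℤ/qℤ)`. -/
def HasEverywhereStrongApprox (A : Set ℕ) : Prop :=
  ∀ q : ℕ, 2 ≤ q → ∀ M : Matrix (Fin 2) (Fin 2) (ZMod q), M.det = 1 →
    ∃ γ ∈ GammaSemigroup A, γ.map ((↑) : ℤ → ZMod q) = M

/-- The odd alphabet `A_odd = {1,3,5,…}`. -/
def oddAlphabet : Set ℕ := {a : ℕ | a % 2 = 1}

/-! ### Generation of `SL₂(ℤ/qℤ)` -/

section Generation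

open Matrix

/-- Lower unipotent matrix. -/
def lowerUnip {R : Type*} [CommRing R] (k : R) : SpecialLinearGroup (Fin 2) R :=
  ⟨!![1, 0; k, 1], by simp [det_fin_two]⟩

/-- Upper unipotent matrix. -/
def upperUnip {R : Type*} [CommRing R] (k : R) : SpecialLinearGroup (Fin 2) R :=
  ⟨!![1, k; 0, 1], by simp [det_fin_two]⟩

lemma coe_lowerUnip {R : Type*} [CommRing R] (k : R) :
    (lowerUnip k : Matrix (Fin 2) (Fin 2) R) = !![1, 0; k, 1] := rfl

lemma coe_upperUnip {R : Type*} [CommRing R] (k : R) :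
    (upperUnip k : Matrix (Fin 2) (Fin 2) R) = !![1, k; 0, 1] := rfl

lemma lowerUnip_add {R : Type*} [CommRing R] (k l : R) :
    lowerUnip (k + l) = lowerUnip k * lowerUnip l := by
  ext i j
  fin_cases i <;> fin_cases j <;> simp [coe_lowerUnip]

lemma upperUnip_add {R : Type*} [CommRing R] (k l : R) :
    upperUnip (k + l) = upperUnip k * upperUnip l := by
  ext i j
  fin_cases i <;> fin_cases j <;> simp [coe_upperUnip, add_comm]

lemma lowerUnip_neg {R : Type*} [CommRing R] (k : R) : lowerUnip (-k) = (lowerUnip k)⁻¹ := by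
  rw [eq_inv_iff_mul_eq_one, ← lowerUnip_add]
  ext i j
  fin_cases i <;> fin_cases j <;> simp [coe_lowerUnip]

lemma upperUnip_neg {R : Type*} [CommRing R] (k : R) : upperUnip (-k) = (upperUnip k)⁻¹ := by
  rw [eq_inv_iff_mul_eq_one, ← upperUnip_add]
  ext i j
  fin_cases i <;> fin_cases j <;> simp [coe_upperUnip]

lemma lowerUnip_mul_zero {R : Type*} [CommRing R] (k : R) (g : SpecialLinearGroup (Fin 2) R) :
    (lowerUnip k * g) 0 0 = g 0 0 := by
  simp [coe_lowerUnip, mul_apply, Fin.sum_univ_two]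

lemma lowerUnip_mul_one {R : Type*} [CommRing R] (k : R) (g : SpecialLinearGroup (Fin 2) R) :
    (lowerUnip k * g) 1 0 = g 1 0 + k * g 0 0 := by
  simp [coe_lowerUnip, mul_apply, Fin.sum_univ_two, add_comm]

lemma upperUnip_mul_zero {R : Type*} [CommRing R] (k : R) (g : SpecialLinearGroup (Fin 2) R) :
    (upperUnip k * g) 0 0 = g 0 0 + k * g 1 0 := by
  simp [coe_upperUnip, mul_apply, Fin.sum_univ_two]

lemma upperUnip_mul_one {R : Type*} [CommRing R] (k : R) (g : SpecialLinearGroup (Fin 2) R) :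
    (upperUnip k * g) 1 0 = g 1 0 := by
  simp [coe_upperUnip, mul_apply, Fin.sum_univ_two]

/-- A subgroup of `SL₂(ℤ/qℤ)` containing all unipotent matrices is everything. -/
lemma mem_of_unip_mem {q : ℕ} [NeZero q] (H : Subgroup (SpecialLinearGroup (Fin 2) (ZMod q)))
    (hL : ∀ k, lowerUnip k ∈ H) (hU : ∀ k, upperUnip k ∈ H)
    (g : SpecialLinearGroup (Fin 2) (ZMod q)) : g ∈ H := by
  have stepL (k) {g : SpecialLinearGroup (Fin 2) (ZMod q)} (h : lowerUnip k * g ∈ H) : g ∈ H :=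
    (H.mul_mem_cancel_left (hL k)).1 h
  have stepU (k) {g : SpecialLinearGroup (Fin 2) (ZMod q)} (h : upperUnip k * g ∈ H) : g ∈ H :=
    (H.mul_mem_cancel_left (hU k)).1 h
  have base (g : SpecialLinearGroup (Fin 2) (ZMod q)) (h0 : g 0 0 = 1) (h1 : g 1 0 = 0) :
      g ∈ H := by
    have hd := g.det_coe
    rw [det_fin_two, h0, h1] at hd
    have : g = upperUnip (g 0 1) := by
      ext i j
      fin_cases i <;> fin_cases j <;> simp [coe_upperUnip, h0, h1]
      simpa using hd
    rw [this]
    exact hU _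
  induction hn : (g 1 0).val using Nat.strong_induction_on generalizing g with
  | _ n ih =>
    by_cases hc : g 1 0 = 0
    · have hd := g.det_coe
      rw [det_fin_two, hc] at hd
      apply stepL (g 1 1)
      apply stepU (1 - g 0 0)
      apply stepL (-1)
      apply base <;>
      simp only [lowerUnip_mul_zero, lowerUnip_mul_one, upperUnip_mul_zero, upperUnip_mul_one, hc]
      · linear_combination (1 - g 0 0) * hd
      · linear_combination (g 0 0) * hd
    · set c := (g 1 0).val with hcdef
      have hcpos : 0 < c := Nat.pos_of_ne_zero (by simpa [hcdef] using hc)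
      have hcq : c < q := ZMod.val_lt _
      set r := (g 0 0).val % c with hr
      have hrc : r < c := Nat.mod_lt _ hcpos
      have hcc : g 1 0 = (c : ZMod q) := (ZMod.natCast_zmod_val _).symm
      have ha : g 0 0 = (c : ZMod q) * ((g 0 0).val / c : ℕ) + (r : ZMod q) := by
        conv_lhs => rw [← ZMod.natCast_zmod_val (g 0 0), ← Nat.div_add_mod (g 0 0).val c]
        push_cast
        rfl
      apply stepU (-((g 0 0).val / c : ℕ) - 1)
      apply stepL 1
      refine ih r (by omega) _ ?_
      rw [lowerUnip_mul_one, upperUnip_mul_zero, upperUnip_mul_one]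
      have : g 1 0 + 1 * (g 0 0 + (-((g 0 0).val / c : ℕ) - 1) * g 1 0) = (r : ZMod q) := by
        linear_combination ha - ((g 0 0).val / c : ℕ) * hcc
      rw [this, ZMod.val_natCast, Nat.mod_eq_of_lt (by omega)]

end Generation

/-! ### Strong approximation when the differences have gcd one -/

lemma det_cfGen (a : ℕ) : (cfGen a).det = -1 := by simp [cfGen, Matrix.det_fin_two]

lemma det_of_mem_GammaSemigroup {A : Set ℕ} {γ : Matrix (Fin 2) (Fin 2) ℤ}
    (h : γ ∈ GammaSemigroup A) : γ.det = 1 := by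
  obtain ⟨l, -, -, rfl⟩ := h
  induction l with
  | nil => simp
  | cons p l ih => simp [Matrix.det_mul, det_cfGen, ih]

lemma mul_mem_GammaSemigroup {A : Set ℕ} {γ γ' : Matrix (Fin 2) (Fin 2) ℤ}
    (h : γ ∈ GammaSemigroup A) (h' : γ' ∈ GammaSemigroup A) : γ * γ' ∈ GammaSemigroup A := by
  obtain ⟨l, hl, hA, rfl⟩ := h
  obtain ⟨l', -, hA', rfl⟩ := h'
  refine ⟨l ++ l', by simp [hl], ?_, by simp⟩
  intro p hp
  rcases List.mem_append.1 hp with h | h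
  exacts [hA p h, hA' p h]

lemma gen_mem_GammaSemigroup {A : Set ℕ} {a b : ℕ} (ha : a ∈ A) (hb : b ∈ A) :
    cfGen a * cfGen b ∈ GammaSemigroup A :=
  ⟨[(a, b)], by simp, by simp [ha, hb], by simp⟩

lemma map_intCast_mul {q : ℕ} (M N : Matrix (Fin 2) (Fin 2) ℤ) :
    (M * N).map ((↑) : ℤ → ZMod q) = M.map ((↑) : ℤ → ZMod q) * N.map ((↑) : ℤ → ZMod q) :=
  Matrix.map_mul (f := Int.castRingHom (ZMod q))

/-- The reduction of `Γ_A` modulo `q`, which is a subgroup because `SL₂(ℤ/qℤ)` is finite. -/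
def gammaReduction (A : Set ℕ) (hA : A.Nonempty) (q : ℕ) [NeZero q] :
    Subgroup (Matrix.SpecialLinearGroup (Fin 2) (ZMod q)) :=
  have mul_mem : ∀ {g h : Matrix.SpecialLinearGroup (Fin 2) (ZMod q)},
      (∃ γ ∈ GammaSemigroup A, γ.map ((↑) : ℤ → ZMod q) = g) →
      (∃ γ ∈ GammaSemigroup A, γ.map ((↑) : ℤ → ZMod q) = h) →
      ∃ γ ∈ GammaSemigroup A, γ.map ((↑) : ℤ → ZMod q) = (g * h : _) := by
    rintro g h ⟨γ, hγ, e⟩ ⟨γ', hγ', e'⟩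
    exact ⟨γ * γ', mul_mem_GammaSemigroup hγ hγ', by rw [map_intCast_mul, e, e']; rfl⟩
  have pow_mem : ∀ {g : Matrix.SpecialLinearGroup (Fin 2) (ZMod q)} (n : ℕ),
      (∃ γ ∈ GammaSemigroup A, γ.map ((↑) : ℤ → ZMod q) = g) →
      ∃ γ ∈ GammaSemigroup A, γ.map ((↑) : ℤ → ZMod q) = (g ^ (n + 1) : _) := by
    intro g n hg
    induction n with
    | zero => simpa using hg
    | succ n ih => rw [pow_succ]; exact mul_mem ih hg
  { carrier := {g | ∃ γ ∈ GammaSemigroup A, γ.map ((↑) : ℤ → ZMod q) = g}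
    mul_mem' := mul_mem
    one_mem' := by
      obtain ⟨a, ha⟩ := hA
      have hdet : ((cfGen a * cfGen a).map ((↑) : ℤ → ZMod q)).det = 1 := by
        have := Int.cast_det (R := ZMod q) (cfGen a * cfGen a)
        rw [← this, det_of_mem_GammaSemigroup (gen_mem_GammaSemigroup ha ha), Int.cast_one]
      let g : Matrix.SpecialLinearGroup (Fin 2) (ZMod q) := ⟨_, hdet⟩
      have hpos := orderOf_pos g
      have h := pow_mem (g := g) (orderOf g - 1) ⟨_, gen_mem_GammaSemigroup ha ha, rfl⟩
      rw [Nat.sub_add_cancel hpos, pow_orderOf_eq_one] at h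
      exact h
    inv_mem' := by
      intro g hg
      have hpos := orderOf_pos g
      have h := pow_mem (g := g) (2 * orderOf g - 2) hg
      have e : g ^ (2 * orderOf g - 2 + 1) = g⁻¹ := by
        rw [eq_inv_iff_mul_eq_one, ← pow_succ]
        rw [show 2 * orderOf g - 2 + 1 + 1 = orderOf g * 2 by omega, pow_mul,
          pow_orderOf_eq_one, one_pow]
      rw [e] at h
      exact h }

lemma hasEverywhereStrongApprox_of_closure {A : Set ℕ} (hA : A.Nonempty)
    (h1 : (1 : ℤ) ∈ AddSubgroup.closure {n : ℤ | ∃ a ∈ A, ∃ b ∈ A, n = a - b}) :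
    HasEverywhereStrongApprox A := by
  intro q hq M hM
  have : NeZero q := ⟨by omega⟩
  let H := gammaReduction A hA q
  have gen_mem (a b : ℕ) (ha : a ∈ A) (hb : b ∈ A)
      (g : Matrix.SpecialLinearGroup (Fin 2) (ZMod q))
      (hg : (g : Matrix (Fin 2) (Fin 2) (ZMod q)) = !![1, (b : ZMod q); (a : ZMod q), 1 + a * b]) :
      g ∈ H := by
    refine ⟨_, gen_mem_GammaSemigroup ha hb, ?_⟩
    rw [hg]
    ext i j
    fin_cases i <;> fin_cases j <;> simp [cfGen]
  let G (a b : ℕ) : Matrix.SpecialLinearGroup (Fin 2) (ZMod q) :=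
    ⟨!![1, (b : ZMod q); (a : ZMod q), 1 + a * b], by rw [Matrix.det_fin_two_of]; ring⟩
  have coe_G (a b : ℕ) : (G a b : Matrix (Fin 2) (Fin 2) (ZMod q)) =
      !![1, (b : ZMod q); (a : ZMod q), 1 + a * b] := rfl
  have hG {a b : ℕ} (ha : a ∈ A) (hb : b ∈ A) : G a b ∈ H := gen_mem a b ha hb _ rfl
  have hLd (n : ℤ) (hn : n ∈ AddSubgroup.closure {n : ℤ | ∃ a ∈ A, ∃ b ∈ A, n = a - b}) :
      lowerUnip (n : ZMod q) ∈ H ∧ upperUnip (n : ZMod q) ∈ H := by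
    induction hn using AddSubgroup.closure_induction with
    | mem n hn =>
      obtain ⟨a, ha, b, hb, rfl⟩ := hn
      constructor
      · have e : lowerUnip ((a - b : ℤ) : ZMod q) * G b a = G a a := by
          ext i j
          fin_cases i <;> fin_cases j <;>
            simp [coe_lowerUnip, coe_G]
          try ring
        exact (H.mul_mem_cancel_right (hG hb ha)).1 (e ▸ hG ha ha)
      · have e : G a b * upperUnip ((a - b : ℤ) : ZMod q) = G a a := by
          ext i j
          fin_cases i <;> fin_cases j <;>
            simp [coe_upperUnip, coe_G]
          try ring
        exact (H.mul_mem_cancel_left (hG ha hb)).1 (e ▸ hG ha ha)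
    | zero =>
      have e1 : lowerUnip ((0 : ℤ) : ZMod q) = 1 := by
        ext i j
        fin_cases i <;> fin_cases j <;> simp [coe_lowerUnip]
      have e2 : upperUnip ((0 : ℤ) : ZMod q) = 1 := by
        ext i j
        fin_cases i <;> fin_cases j <;> simp [coe_upperUnip]
      rw [e1, e2]
      exact ⟨H.one_mem, H.one_mem⟩
    | add x y _ _ hx hy =>
      rw [Int.cast_add, lowerUnip_add, upperUnip_add]
      exact ⟨H.mul_mem hx.1 hy.1, H.mul_mem hx.2 hy.2⟩
    | neg x _ hx =>
      rw [Int.cast_neg, lowerUnip_neg, upperUnip_neg]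
      exact ⟨H.inv_mem hx.1, H.inv_mem hx.2⟩
  have hall (k : ZMod q) : lowerUnip k ∈ H ∧ upperUnip k ∈ H := by
    have := hLd (k.val : ℤ) (by simpa using AddSubgroup.zsmul_mem _ h1 (k.val : ℤ))
    simpa using this
  exact mem_of_unip_mem H (fun k => (hall k).1) (fun k => (hall k).2) ⟨M, hM⟩

lemma exists_modulus_of_not_strongApprox {A : Set ℕ} (hA : A.Nonempty)
    (h : ¬ HasEverywhereStrongApprox A) :
    ∃ d : ℕ, 2 ≤ d ∧ ∀ a ∈ A, ∀ b ∈ A, (d : ℤ) ∣ a - b := by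
  obtain ⟨g, hg⟩ := Int.subgroup_cyclic
    (AddSubgroup.closure {n : ℤ | ∃ a ∈ A, ∃ b ∈ A, n = a - b})
  have hdvd (a) (ha : a ∈ A) (b) (hb : b ∈ A) : g ∣ (a : ℤ) - b := by
    have hmem : (a : ℤ) - b ∈ AddSubgroup.closure {n : ℤ | ∃ a ∈ A, ∃ b ∈ A, n = a - b} :=
      AddSubgroup.subset_closure ⟨a, ha, b, hb, rfl⟩
    rw [hg, ← AddSubgroup.zmultiples_eq_closure, Int.mem_zmultiples_iff] at hmem
    exact hmem
  have hg1 : g.natAbs ≠ 1 := by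
    intro hg1
    apply h
    apply hasEverywhereStrongApprox_of_closure hA
    rw [hg, ← AddSubgroup.zmultiples_eq_closure, Int.mem_zmultiples_iff]
    exact isUnit_iff_dvd_one.1 (Int.isUnit_iff_natAbs_eq.2 hg1)
  by_cases hg0 : g = 0
  · refine ⟨2, le_rfl, fun a ha b hb => ?_⟩
    have := hdvd a ha b hb
    rw [hg0, zero_dvd_iff] at this
    simp [this]
  · exact ⟨g.natAbs, by omega, fun a ha b hb => Int.natAbs_dvd.2 (hdvd a ha b hb)⟩

/-! ### Failure modulo two for the odd alphabet -/

lemma map_mod_two_of_mem {γ : Matrix (Fin 2) (Fin 2) ℤ} (h : γ ∈ GammaSemigroup oddAlphabet) :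
    γ.map ((↑) : ℤ → ZMod 2) ≠ !![0, 1; 1, 0] := by
  obtain ⟨l, -, hl, rfl⟩ := h
  have key : ((l.map (fun p => cfGen p.1 * cfGen p.2)).prod).map ((↑) : ℤ → ZMod 2) ∈
      ({1, !![1, 1; 1, 0], !![0, 1; 1, 1]} : Set (Matrix (Fin 2) (Fin 2) (ZMod 2))) := by
    induction l with
    | nil => left; simp [Matrix.map_one]
    | cons p l ih =>
      have ih := ih (fun p hp => hl p (List.mem_cons_of_mem _ hp))
      have hp := hl p List.mem_cons_self
      have h1 : ((p.1 : ℕ) : ZMod 2) = 1 := (ZMod.natCast_eq_one_iff_odd).2 (Nat.odd_iff.2 hp.1)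
      have h2 : ((p.2 : ℕ) : ZMod 2) = 1 := (ZMod.natCast_eq_one_iff_odd).2 (Nat.odd_iff.2 hp.2)
      have e : (cfGen p.1 * cfGen p.2).map ((↑) : ℤ → ZMod 2) = !![1, 1; 1, 0] := by
        ext i j
        fin_cases i <;> fin_cases j <;>
          simp [cfGen, h1, h2]
        decide
      rw [List.map_cons, List.prod_cons, map_intCast_mul, e]
      rcases ih with h | h | h <;> rw [h]
      · right; left; simp
      · right; right; decide
      · left; decide
  intro h
  rw [h] at key
  rcases key with h | h | h <;> revert h <;> decide

/-! ### Continued fraction expansions as orbits -/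

/-- `s` is the Gauss orbit of a point with partial quotients `a`. -/
structure IsCFOrbit (a : ℕ → ℕ) (s : ℕ → ℝ) : Prop where
  one_le : ∀ n, 1 ≤ a n
  pos : ∀ n, 0 < s n
  lt_one : ∀ n, s n < 1
  mul_eq : ∀ n, s n * (a n + s (n + 1)) = 1

namespace IsCFOrbit

variable {a b : ℕ → ℕ} {s t : ℕ → ℝ}

lemma inv_eq (h : IsCFOrbit a s) (n : ℕ) : (s n)⁻¹ = a n + s (n + 1) :=
  inv_eq_of_mul_eq_one_right (h.mul_eq n)

lemma floor_inv (h : IsCFOrbit a s) (n : ℕ) : ⌊(s n)⁻¹⌋ = (a n : ℤ) := by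
  rw [h.inv_eq, Int.floor_eq_iff]
  have := h.pos (n + 1)
  have := h.lt_one (n + 1)
  constructor <;> push_cast <;> linarith

lemma gaussMap_eq (h : IsCFOrbit a s) (n : ℕ) : gaussMap (s n) = s (n + 1) := by
  rw [gaussMap, Int.fract, h.floor_inv, h.inv_eq]
  push_cast
  ring

lemma iterate_eq (h : IsCFOrbit a s) (n : ℕ) : gaussMap^[n] (s 0) = s n := by
  induction n with
  | zero => rfl
  | succ n ih => rw [Function.iterate_succ_apply', ih, h.gaussMap_eq]

lemma partialQuot_eq (h : IsCFOrbit a s) (n : ℕ) : partialQuot (s 0) n = a n := by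
  rw [partialQuot, h.iterate_eq, h.floor_inv]

lemma irrational (h : IsCFOrbit a s) : Irrational (s 0) := by
  have key (q : ℕ) : ∀ n (p : ℤ), s n * q ≠ p ∨ q = 0 := by
    induction q using Nat.strong_induction_on with
    | _ q ih =>
      intro n p
      by_contra! hp
      obtain ⟨hp, hq⟩ := hp
      have hq' : (0 : ℝ) < q := by exact_mod_cast Nat.pos_of_ne_zero hq
      have p0 : 0 < p := by exact_mod_cast hp ▸ mul_pos (h.pos n) hq'
      have pq : p < q := by
        have : (p : ℝ) < q := by rw [← hp]; nlinarith [h.lt_one n]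
        exact_mod_cast this
      lift p to ℕ using p0.le
      have := ih p (by omega) (n + 1) (q - a n * p)
      rcases this with h' | h'
      · apply h'
        have e := h.mul_eq n
        push_cast at hp ⊢
        rw [← hp]
        linear_combination (q : ℝ) * e
      · omega
  rintro ⟨r, hr⟩
  rcases key r.den 0 r.num with h' | h'
  · apply h'
    rw [← hr]
    exact_mod_cast Rat.mul_den_eq_num r
  · exact r.den_ne_zero h'

lemma mem_cfCantorSet (h : IsCFOrbit a s) {A : Set ℕ} (hA : ∀ n, a n ∈ A) :
    s 0 ∈ cfCantorSet A :=
  ⟨h.irrational, ⟨h.pos 0, h.lt_one 0⟩, fun n => ⟨a n, hA n, h.partialQuot_eq n⟩⟩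

end IsCFOrbit

lemma gaussMap_irrational {x : ℝ} (h : Irrational x) : Irrational (gaussMap x) := by
  rw [gaussMap, Int.fract]
  exact (irrational_inv_iff.2 h).sub_intCast _

lemma exists_orbit_of_mem_cfCantorSet {A : Set ℕ} (hA : ∀ a ∈ A, 0 < a) {x : ℝ}
    (hx : x ∈ cfCantorSet A) :
    ∃ a : ℕ → ℕ, (∀ n, a n ∈ A) ∧ IsCFOrbit a (fun n => gaussMap^[n] x) := by
  obtain ⟨hirr, h01, hdig⟩ := hx
  choose a ha e using hdig
  have hi (n : ℕ) : Irrational (gaussMap^[n] x) := by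
    induction n with
    | zero => exact hirr
    | succ n ih => rw [Function.iterate_succ_apply']; exact gaussMap_irrational ih
  have hb (n : ℕ) : 0 < gaussMap^[n] x ∧ gaussMap^[n] x < 1 := by
    cases n with
    | zero => exact h01
    | succ n =>
      refine ⟨lt_of_le_of_ne ?_ (hi (n + 1)).ne_zero.symm, ?_⟩ <;>
        rw [Function.iterate_succ_apply', gaussMap]
      exacts [Int.fract_nonneg _, Int.fract_lt_one _]
  refine ⟨a, ha, fun n => hA _ (ha n), fun n => (hb n).1, fun n => (hb n).2, fun n => ?_⟩
  have h1 : (a n : ℝ) + gaussMap^[n + 1] x = (gaussMap^[n] x)⁻¹ := by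
    rw [Function.iterate_succ_apply', gaussMap]
    have := e n
    rw [partialQuot] at this
    have h2 := Int.floor_add_fract (gaussMap^[n] x)⁻¹
    rw [this] at h2
    exact_mod_cast h2
  simp only [h1]
  exact mul_inv_cancel₀ (hb n).1.ne'

/-- Closed cylinders of points whose first `n` partial quotients are prescribed by `b`. -/
def cfCylinder : ℕ → (ℕ → ℕ) → Set ℝ
  | 0, _ => Set.Icc 0 1
  | n + 1, b => (fun t : ℝ => ((b 0 : ℝ) + t)⁻¹) '' cfCylinder n (fun i => b (i + 1))

lemma cfCylinder_subset_Icc (n : ℕ) (b : ℕ → ℕ) (hb : ∀ i, 1 ≤ b i) :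
    cfCylinder n b ⊆ Set.Icc 0 1 := by
  induction n generalizing b with
  | zero => exact subset_rfl
  | succ n ih =>
    rintro _ ⟨t, ht, rfl⟩
    have ht := ih _ (fun i => hb (i + 1)) ht
    have h1 : (1 : ℝ) ≤ b 0 := by exact_mod_cast hb 0
    have : (1 : ℝ) ≤ b 0 + t := by linarith [ht.1]
    exact ⟨by positivity, inv_le_one_of_one_le₀ this⟩

lemma cfCylinder_anti (n : ℕ) (b : ℕ → ℕ) (hb : ∀ i, 1 ≤ b i) :
    cfCylinder (n + 1) b ⊆ cfCylinder n b := by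
  induction n generalizing b with
  | zero => exact cfCylinder_subset_Icc 1 b hb
  | succ n ih => exact Set.image_mono (ih _ (fun i => hb (i + 1)))

lemma isCompact_cfCylinder (n : ℕ) (b : ℕ → ℕ) (hb : ∀ i, 1 ≤ b i) :
    IsCompact (cfCylinder n b) := by
  induction n generalizing b with
  | zero => exact isCompact_Icc
  | succ n ih =>
    refine (ih _ (fun i => hb (i + 1))).image_of_continuousOn ?_
    refine ContinuousOn.inv₀ (by fun_prop) fun t ht => ?_
    have ht := cfCylinder_subset_Icc _ _ (fun i => hb (i + 1)) ht
    have h1 : (1 : ℝ) ≤ b 0 := by exact_mod_cast hb 0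
    linarith [ht.1]

lemma cfCylinder_nonempty (n : ℕ) (b : ℕ → ℕ) : (cfCylinder n b).Nonempty := by
  induction n generalizing b with
  | zero => exact ⟨0, by simp [cfCylinder]⟩
  | succ n ih => exact (ih _).image _

/-- Every sequence of positive integers is the sequence of partial quotients of some point. -/
lemma exists_orbit (b : ℕ → ℕ) (hb : ∀ i, 1 ≤ b i) : ∃ s, IsCFOrbit b s := by
  obtain ⟨x, hx⟩ := IsCompact.nonempty_iInter_of_sequence_nonempty_isCompact_isClosed
    (fun n => cfCylinder n b) (fun n => cfCylinder_anti n b hb) (fun n => cfCylinder_nonempty n b)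
    (isCompact_cfCylinder 0 b hb) (fun n => (isCompact_cfCylinder n b hb).isClosed)
  rw [Set.mem_iInter] at hx
  let s : ℕ → ℝ := fun n => Nat.rec x (fun n y => y⁻¹ - b n) n
  have hs (n : ℕ) : s (n + 1) = (s n)⁻¹ - b n := rfl
  have mem (n : ℕ) : ∀ m, s n ∈ cfCylinder m (fun i => b (n + i)) := by
    induction n with
    | zero => simp only [zero_add]; exact hx
    | succ n ih =>
      intro m
      obtain ⟨t, ht, e⟩ := ih (m + 1)
      have : s (n + 1) = t := by rw [hs, ← e]; simp
      rw [this]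
      simpa [add_assoc, add_comm 1] using ht
  have nonneg (n : ℕ) : 0 ≤ s n := (mem n 0).1
  have pos (n : ℕ) : 0 < s n := by
    obtain ⟨t, ht, e⟩ := mem n 1
    have h1 : (1 : ℝ) ≤ b n := by exact_mod_cast hb n
    rw [← e]
    have := ht.1
    simp only [add_zero]
    positivity
  have eq (n : ℕ) : s n * (b n + s (n + 1)) = 1 := by
    rw [hs]
    have := (pos n).ne'
    field_simp
    ring
  refine ⟨s, hb, pos, fun n => ?_, eq⟩
  have h1 : (1 : ℝ) ≤ b n := by exact_mod_cast hb n
  nlinarith [eq n, pos n, pos (n + 1), mul_pos (pos n) (pos (n + 1))]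

/-! ### Comparison of orbits -/

/-- The pair `(qₙ, qₙ₋₁)` of consecutive convergent denominators. -/
def cfDen (a : ℕ → ℕ) : ℕ → ℕ × ℕ
  | 0 => (1, 0)
  | n + 1 => (a n * (cfDen a n).1 + (cfDen a n).2, (cfDen a n).1)

lemma cfDen_mono {a b : ℕ → ℕ} (h : ∀ n, b n ≤ a n) (n : ℕ) :
    (cfDen b n).1 ≤ (cfDen a n).1 ∧ (cfDen b n).2 ≤ (cfDen a n).2 := by
  induction n with
  | zero => simp [cfDen]
  | succ n ih => exact ⟨Nat.add_le_add (Nat.mul_le_mul (h n) ih.1) ih.2, ih.1⟩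

lemma cfDen_snd_le {a : ℕ → ℕ} (h : ∀ n, 1 ≤ a n) (n : ℕ) :
    (cfDen a n).2 ≤ (cfDen a n).1 ∧ 1 ≤ (cfDen a n).1 := by
  induction n with
  | zero => simp [cfDen]
  | succ n ih =>
    simp only [cfDen]
    have := Nat.mul_le_mul_right (cfDen a n).1 (h n)
    omega

lemma le_cfDen {a : ℕ → ℕ} (h : ∀ n, 1 ≤ a n) (n : ℕ) :
    n ≤ (cfDen a n).1 ∧ (n = 0 ∨ 1 ≤ (cfDen a n).2) := by
  induction n with
  | zero => simp
  | succ n ih =>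
    have := cfDen_snd_le h n
    simp only [cfDen]
    have := Nat.mul_le_mul_right (cfDen a n).1 (h n)
    omega

/-- The product of the first `n` points of an orbit. -/
noncomputable def orbitProd (s : ℕ → ℝ) (n : ℕ) : ℝ := ∏ i ∈ Finset.range n, s i

namespace IsCFOrbit

variable {a b : ℕ → ℕ} {s t u v : ℕ → ℝ}

lemma orbitProd_pos (h : IsCFOrbit a s) (n : ℕ) : 0 < orbitProd s n :=
  Finset.prod_pos fun i _ => h.pos i

lemma orbitProd_mul (h : IsCFOrbit a s) (n : ℕ) :
    orbitProd s n * ((cfDen a n).1 + (cfDen a n).2 * s n) = 1 := by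
  induction n with
  | zero => simp [orbitProd, cfDen]
  | succ n ih =>
    have e : orbitProd s (n + 1) = orbitProd s n * s n := Finset.prod_range_succ _ _
    rw [e]
    simp only [cfDen]
    push_cast
    linear_combination ih + orbitProd s n * (cfDen a n).1 * h.mul_eq n

lemma orbitProd_mul_den_le (h : IsCFOrbit a s) (n : ℕ) :
    orbitProd s n * (cfDen a n).1 ≤ 1 := by
  have := h.orbitProd_mul n
  have h0 : 0 ≤ orbitProd s n * ((cfDen a n).2 * s n) :=
    mul_nonneg (h.orbitProd_pos n).le (mul_nonneg (Nat.cast_nonneg _) (h.pos n).le)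
  linarith [mul_add (orbitProd s n) ((cfDen a n).1 : ℝ) ((cfDen a n).2 * s n)]

lemma orbitProd_le (h : IsCFOrbit a s) (h' : IsCFOrbit b u) (hab : ∀ n, b n ≤ a n) (n : ℕ) :
    orbitProd s n ≤ 2 * orbitProd u n := by
  have h1 := h.orbitProd_mul_den_le n
  have h2 := h'.orbitProd_mul n
  have ps := h.orbitProd_pos n
  have pu := h'.orbitProd_pos n
  have q1 : ((cfDen b n).1 : ℝ) ≤ (cfDen a n).1 := by exact_mod_cast (cfDen_mono hab n).1
  have q2 : ((cfDen b n).2 : ℝ) ≤ (cfDen b n).1 := by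
    exact_mod_cast (cfDen_snd_le h'.one_le n).1
  have q3 : (1 : ℝ) ≤ (cfDen a n).1 := by exact_mod_cast (cfDen_snd_le h.one_le n).2
  have h3 : ((cfDen b n).1 : ℝ) + (cfDen b n).2 * u n ≤ 2 * (cfDen a n).1 := by
    have : ((cfDen b n).2 : ℝ) * u n ≤ (cfDen b n).2 :=
      mul_le_of_le_one_right (Nat.cast_nonneg _) (h'.lt_one n).le
    linarith
  have h4 : 1 ≤ orbitProd u n * (2 * (cfDen a n).1) := by
    rw [← h2]
    exact mul_le_mul_of_nonneg_left h3 pu.le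
  have h5 : orbitProd s n * (cfDen a n).1 ≤ 2 * orbitProd u n * (cfDen a n).1 := by linarith
  exact le_of_mul_le_mul_right h5 (by linarith)

lemma abs_sub_eq (h : IsCFOrbit a s) (h' : IsCFOrbit b t) (n : ℕ) (hab : ∀ i < n, a i = b i) :
    |s 0 - t 0| = orbitProd s n * orbitProd t n * |s n - t n| := by
  induction n with
  | zero => simp [orbitProd]
  | succ n ih =>
    rw [ih fun i hi => hab i (by omega)]
    have e : orbitProd s (n + 1) = orbitProd s n * s n := Finset.prod_range_succ _ _
    have e' : orbitProd t (n + 1) = orbitProd t n * t n := Finset.prod_range_succ _ _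
    have e2 : s n - t n = -(s n * t n * (s (n + 1) - t (n + 1))) := by
      have h1 := h.mul_eq n
      have h2 := h'.mul_eq n
      rw [hab n (by omega)] at h1
      linear_combination (-s n) * h2 + t n * h1
    have e3 : |s n - t n| = s n * t n * |s (n + 1) - t (n + 1)| := by
      rw [e2, abs_neg, abs_mul, abs_of_pos (mul_pos (h.pos n) (h'.pos n))]
    rw [e, e', e3]
    ring

lemma abs_sub_le (h : IsCFOrbit a s) (h' : IsCFOrbit b t) (n : ℕ) : |s n - t n| ≤ 1 := by
  rw [abs_le]
  constructor <;> linarith [h.pos n, h.lt_one n, h'.pos n, h'.lt_one n]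

lemma eq_of_digits_eq (h : IsCFOrbit a s) (h' : IsCFOrbit a t) : s 0 = t 0 := by
  by_contra hne
  have hpos : 0 < |s 0 - t 0| := abs_pos.2 (sub_ne_zero.2 hne)
  obtain ⟨n, hn⟩ := exists_nat_gt (|s 0 - t 0|)⁻¹
  have hn' : 1 < |s 0 - t 0| * n := by
    rwa [inv_lt_iff_one_lt_mul₀ hpos, mul_comm] at hn
  have e := h.abs_sub_eq h' n fun _ _ => rfl
  have qn : (n : ℝ) ≤ (cfDen a n).1 := by exact_mod_cast (le_cfDen h.one_le n).1
  have q1 : (1 : ℝ) ≤ (cfDen a n).1 := by exact_mod_cast (cfDen_snd_le h.one_le n).2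
  have p1 := h.orbitProd_mul_den_le n
  have p2 := h'.orbitProd_mul_den_le n
  have ps := h.orbitProd_pos n
  have pt := h'.orbitProd_pos n
  have t1 : orbitProd t n ≤ 1 := by nlinarith
  have s1 : orbitProd s n * n ≤ 1 := by nlinarith
  have : |s 0 - t 0| ≤ orbitProd s n := by
    rw [e]
    have := h.abs_sub_le h' n
    calc orbitProd s n * orbitProd t n * |s n - t n|
        ≤ orbitProd s n * 1 * 1 := by gcongr
      _ = orbitProd s n := by ring
  nlinarith [Nat.cast_nonneg (α := ℝ) n]

end IsCFOrbit

/-- Comparison of two inverse Gauss branches when the partial quotients `r + d * k` are replaced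
by `2 * k + 1`. -/
lemma branch_comparison {r d k l x y x' y' u v u' v' : ℝ} (hr : 1 ≤ r) (hd : 2 ≤ d) (hk : 0 ≤ k)
    (hkl : k + 1 ≤ l) (hx' : 0 < x' ∧ x' < 1) (hy' : 0 < y' ∧ y' < 1) (hu' : 0 < u' ∧ u' < 1)
    (hv' : 0 < v' ∧ v' < 1) (hx : x * (r + d * k + x') = 1) (hy : y * (r + d * l + y') = 1)
    (hu : u * (2 * k + 1 + u') = 1) (hv : v * (2 * l + 1 + v') = 1) :
    |x - y| ≤ 8 * d * |u - v| := by
  obtain ⟨hx0, hx1⟩ := hx'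
  obtain ⟨hy0, hy1⟩ := hy'
  obtain ⟨hu0, hu1⟩ := hu'
  obtain ⟨hv0, hv1⟩ := hv'
  have hdk : 2 * k ≤ d * k := by nlinarith
  have hdl : 2 * l ≤ d * l := by nlinarith
  have hdkl : 2 * (l - k) ≤ d * (l - k) := by nlinarith
  have X : 0 < r + d * k + x' := by linarith
  have Y : 0 < r + d * l + y' := by linarith
  have U : 0 < 2 * k + 1 + u' := by linarith
  have V : 0 < 2 * l + 1 + v' := by linarith
  have ex : x = 1 / (r + d * k + x') := by rw [eq_div_iff X.ne', hx]
  have ey : y = 1 / (r + d * l + y') := by rw [eq_div_iff Y.ne', hy]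
  have eu : u = 1 / (2 * k + 1 + u') := by rw [eq_div_iff U.ne', hu]
  have ev : v = 1 / (2 * l + 1 + v') := by rw [eq_div_iff V.ne', hv]
  have exy : x - y = (d * (l - k) + y' - x') / ((r + d * k + x') * (r + d * l + y')) := by
    rw [ex, ey]; field_simp; ring
  have euv : u - v = (2 * (l - k) + v' - u') / ((2 * k + 1 + u') * (2 * l + 1 + v')) := by
    rw [eu, ev]; field_simp; ring
  have bx : 0 ≤ x - y := by
    rw [exy]; apply div_nonneg (by linarith) (by positivity)
  have bu : 0 ≤ u - v := by
    rw [euv]; apply div_nonneg (by linarith) (by positivity)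
  rw [abs_of_nonneg bx, abs_of_nonneg bu]
  have B : 0 < (2 * k + 1) * (2 * l + 1) := mul_pos (by linarith) (by linarith)
  have h1 : x - y ≤ 2 * d * (l - k) / ((2 * k + 1) * (2 * l + 1)) := by
    rw [exy]
    apply div_le_div₀ _ _ B _
    · exact mul_nonneg (by linarith) (by linarith)
    · linarith
    · apply mul_le_mul <;> linarith
  have h2 : (l - k) / (4 * ((2 * k + 1) * (2 * l + 1))) ≤ u - v := by
    rw [euv]
    apply div_le_div₀ _ _ (mul_pos U V) _
    · linarith
    · linarith
    · calc (2 * k + 1 + u') * (2 * l + 1 + v')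
          ≤ (2 * (2 * k + 1)) * (2 * (2 * l + 1)) := by apply mul_le_mul <;> linarith
        _ = _ := by ring
  calc x - y ≤ 2 * d * (l - k) / ((2 * k + 1) * (2 * l + 1)) := h1
    _ = 8 * d * ((l - k) / (4 * ((2 * k + 1) * (2 * l + 1)))) := by field_simp; ring
    _ ≤ 8 * d * (u - v) := mul_le_mul_of_nonneg_left h2 (by linarith)

/-- Replacing the partial quotients `r + d * k` by `2 * k + 1` contracts distances by at most a
constant factor. -/
lemma orbit_comparison {r d : ℕ} (hr : 1 ≤ r) (hd : 2 ≤ d) {k l : ℕ → ℕ} {s t u v : ℕ → ℝ}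
    (hs : IsCFOrbit (fun n => r + d * k n) s) (ht : IsCFOrbit (fun n => r + d * l n) t)
    (hu : IsCFOrbit (fun n => 2 * k n + 1) u) (hv : IsCFOrbit (fun n => 2 * l n + 1) v) :
    |s 0 - t 0| ≤ 32 * d * |u 0 - v 0| := by
  by_cases hkl : k = l
  · subst hkl
    rw [hs.eq_of_digits_eq ht, sub_self, abs_zero]
    positivity
  have hex : ∃ n, k n ≠ l n := Function.ne_iff.1 hkl
  classical
  let n := Nat.find hex
  have hn : k n ≠ l n := Nat.find_spec hex
  have hlt (i) (hi : i < n) : k i = l i := not_not.1 (Nat.find_min hex hi)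
  rw [hs.abs_sub_eq ht n fun i hi => by rw [hlt i hi],
    hu.abs_sub_eq hv n fun i hi => by rw [hlt i hi]]
  have le (m : ℕ) : 2 * m + 1 ≤ r + d * m := by nlinarith
  have p1 := hs.orbitProd_le hu (fun n => le _) n
  have p2 := ht.orbitProd_le hv (fun n => le _) n
  have hr' : (1 : ℝ) ≤ r := by exact_mod_cast hr
  have hd' : (2 : ℝ) ≤ d := by exact_mod_cast hd
  have p3 : |s n - t n| ≤ 8 * d * |u n - v n| := by
    have e1 := hs.mul_eq n
    have e2 := ht.mul_eq n
    have e3 := hu.mul_eq n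
    have e4 := hv.mul_eq n
    push_cast at e1 e2 e3 e4
    have b1 := And.intro (hs.pos (n + 1)) (hs.lt_one (n + 1))
    have b2 := And.intro (ht.pos (n + 1)) (ht.lt_one (n + 1))
    have b3 := And.intro (hu.pos (n + 1)) (hu.lt_one (n + 1))
    have b4 := And.intro (hv.pos (n + 1)) (hv.lt_one (n + 1))
    rcases lt_or_gt_of_ne hn with h | h
    · exact branch_comparison hr' hd' (Nat.cast_nonneg _) (by exact_mod_cast h)
        b1 b2 b3 b4 e1 e2 e3 e4
    · rw [abs_sub_comm, abs_sub_comm (u n)]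
      exact branch_comparison hr' hd' (Nat.cast_nonneg _) (by exact_mod_cast h)
        b2 b1 b4 b3 e2 e1 e4 e3
  have := hs.orbitProd_pos n
  have := ht.orbitProd_pos n
  have := hu.orbitProd_pos n
  have := hv.orbitProd_pos n
  calc orbitProd s n * orbitProd t n * |s n - t n|
      ≤ (2 * orbitProd u n) * (2 * orbitProd v n) * (8 * d * |u n - v n|) := by gcongr
    _ = _ := by ring

/-- An alphabet contained in a single residue class has dimension at most that of the odds. -/
lemma dimH_cfCantorSet_le_odd {A : Set ℕ} (hA : A.Nonempty) (hpos : ∀ a ∈ A, 0 < a) {d : ℕ}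
    (hd : 2 ≤ d) (hdvd : ∀ a ∈ A, ∀ b ∈ A, (d : ℤ) ∣ a - b) :
    dimH (cfCantorSet A) ≤ dimH (cfCantorSet oddAlphabet) := by
  let r := sInf A
  have hrA : r ∈ A := Nat.sInf_mem hA
  have hform (a) (ha : a ∈ A) : ∃ k : ℕ, a = r + d * k := by
    obtain ⟨k, hk⟩ := hdvd a ha r hrA
    have hle : r ≤ a := Nat.sInf_le ha
    have hk0 : 0 ≤ k := by
      have : 0 ≤ (d : ℤ) * k := by rw [← hk]; omega
      exact nonneg_of_mul_nonneg_right this (by omega)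
    lift k to ℕ using hk0
    exact ⟨k, by zify; linarith⟩
  have hex (x : cfCantorSet A) : ∃ (k : ℕ → ℕ) (s u : ℕ → ℝ), s 0 = x ∧
      IsCFOrbit (fun n => r + d * k n) s ∧ IsCFOrbit (fun n => 2 * k n + 1) u := by
    obtain ⟨a, ha, hs⟩ := exists_orbit_of_mem_cfCantorSet hpos x.2
    choose k hk using fun n => hform (a n) (ha n)
    obtain ⟨u, hu⟩ := exists_orbit (fun n => 2 * k n + 1) (fun n => by omega)
    obtain rfl : a = fun n => r + d * k n := funext hk
    exact ⟨k, _, u, rfl, hs, hu⟩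
  choose k s u hsx hs hu using hex
  let f : cfCantorSet A → ℝ := fun x => u x 0
  have hf : AntilipschitzWith (32 * d) f := by
    refine AntilipschitzWith.of_le_mul_dist fun x y => ?_
    rw [Subtype.dist_eq, Real.dist_eq, Real.dist_eq, ← hsx x, ← hsx y]
    have := orbit_comparison (hpos r hrA) hd (hs x) (hs y) (hu x) (hu y)
    simpa using this
  calc dimH (cfCantorSet A) = dimH (Set.univ : Set (cfCantorSet A)) := by
        have h := (isometry_subtype_coe (s := cfCantorSet A)).dimH_image Set.univ
        rwa [Set.image_univ, Subtype.range_coe] at h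
    _ ≤ dimH (f '' Set.univ) := hf.le_dimH_image _
    _ ≤ dimH (cfCantorSet oddAlphabet) := by
        apply dimH_mono
        rintro _ ⟨x, -, rfl⟩
        exact (hu x).mem_cfCantorSet fun n => by simp [oddAlphabet, Nat.add_mod]

/-- (i) The reduction mod 2 of `Γ_{A_odd}` is a proper subset of `SL₂(ℤ/2ℤ)`, so
`Γ_{A_odd}` fails everywhere strong approximation; (ii) among all alphabets whose
determinant-one semigroup fails everywhere strong approximation, `A_odd` has the
largest Hausdorff dimension. -/
theorem oddAlphabet_maximal_without_strong_approx :
    ({M : Matrix (Fin 2) (Fin 2) (ZMod 2) |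
        ∃ γ ∈ GammaSemigroup oddAlphabet, γ.map ((↑) : ℤ → ZMod 2) = M} ⊂
      {M : Matrix (Fin 2) (Fin 2) (ZMod 2) | M.det = 1}) ∧
    ¬ HasEverywhereStrongApprox oddAlphabet ∧
    (∀ A : Set ℕ, A.Nonempty → (∀ a ∈ A, 0 < a) →
      ¬ HasEverywhereStrongApprox A →
      dimH (cfCantorSet A) ≤ dimH (cfCantorSet oddAlphabet)) := by
  have hdet : (!![0, 1; 1, 0] : Matrix (Fin 2) (Fin 2) (ZMod 2)).det = 1 := by decide
  refine ⟨⟨?_, fun hsub => ?_⟩, fun h => ?_, fun A hA hpos hnot => ?_⟩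
  · rintro _ ⟨γ, hγ, rfl⟩
    have := Int.cast_det (R := ZMod 2) γ
    rw [det_of_mem_GammaSemigroup hγ, Int.cast_one] at this
    exact this.symm
  · obtain ⟨γ, hγ, e⟩ := hsub hdet
    exact map_mod_two_of_mem hγ e
  · obtain ⟨γ, hγ, e⟩ := h 2 le_rfl _ hdet
    exact map_mod_two_of_mem hγ e
  · obtain ⟨d, hd, hdvd⟩ := exists_modulus_of_not_strongApprox hA hnot
    exact dimH_cfCantorSet_le_odd hA hpos hd hdvd
end

section
/- Let A_oct = {a ∈ ℕ : a ≥ 1 and a ≡ 1 (mod 8)} = 8ℕ − 7. For every nonempty set A of positive integers with 1 ∈ A such that A has local obstructions (i.e. there exists an integer q ≥ 2 for which the reduction of D_A modulo q is not all of ℤ/qℤ), one has δ_A ≤ δ_{A_oct}. That is, among all alphabets containing 1 that have local obstructions, A_oct has the largest Hausdorff dimension. -/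
open scoped ENNReal

/-- The semigroup `G_A`: all nonempty finite products of the generators
`[[0,1],[1,a]]` with `a ∈ A`. -/
def GSemigroup (A : Set ℕ) : Set (Matrix (Fin 2) (Fin 2) ℤ) :=
  { M | ∃ l : List ℕ, l ≠ [] ∧ (∀ a ∈ l, a ∈ A) ∧ M = (l.map cfGen).prod }

/-- The set `D_A` of bottom-right entries of matrices in `G_A`. -/
def Denoms (A : Set ℕ) : Set ℕ :=
  { d | ∃ M ∈ GSemigroup A, M 1 1 = (d : ℤ) }

/-- `A` has no local obstructions if for every `q ≥ 2` the reduction of `D_A`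
mod `q` is all of `ℤ/qℤ`. -/
def HasNoLocalObstructions (A : Set ℕ) : Prop :=
  ∀ q : ℕ, 2 ≤ q → ∀ r : ZMod q, ∃ d ∈ Denoms A, (d : ZMod q) = r

/-- The alphabet `A_oct = 8ℕ − 7 = {a ≥ 1 : a ≡ 1 (mod 8)}`. -/
def octAlphabet : Set ℕ := {a : ℕ | 1 ≤ a ∧ a % 8 = 1}

section LocalObstructions

/-- The generator `[[0,1],[1,c]]` over an arbitrary semiring. -/
def cfGenOver {R : Type*} [Semiring R] (c : R) : Matrix (Fin 2) (Fin 2) R := !![0, 1; 1, c]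

/-- The upper unipotent matrix `[[1,c],[0,1]]`. -/
def upperUnipotent {R : Type*} [Semiring R] (c : R) : Matrix (Fin 2) (Fin 2) R := !![1, c; 0, 1]

/-- The monoid generated by the reductions modulo `q` of the generators of `G_A`. -/
def reducedMonoid (A : Set ℕ) (q : ℕ) : Submonoid (Matrix (Fin 2) (Fin 2) (ZMod q)) :=
  Submonoid.closure ((fun a : ℕ => cfGenOver (a : ZMod q)) '' A)

lemma map_cfGenOver {R S : Type*} [Semiring R] [Semiring S] (f : R →+* S) (c : R) :
    f.mapMatrix (cfGenOver c) = cfGenOver (f c) := by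
  ext i j
  fin_cases i <;> fin_cases j <;> simp [cfGenOver]

lemma map_prod_cfGenOver {S : Type*} [Semiring S] (l : List ℕ) :
    (Nat.castRingHom S).mapMatrix ((l.map cfGenOver).prod) =
      (l.map fun a : ℕ => cfGenOver (a : S)).prod := by
  rw [map_list_prod, List.map_map]
  congr 1
  refine List.map_congr_left fun a _ => ?_
  simpa using map_cfGenOver (Nat.castRingHom S) a

lemma prod_cfGenOver_mem_denoms {A : Set ℕ} {l : List ℕ} (hl : l ≠ []) (hA : ∀ a ∈ l, a ∈ A) :
    (l.map cfGenOver).prod 1 1 ∈ Denoms A := by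
  refine ⟨(l.map cfGen).prod, ⟨l, hl, hA, rfl⟩, ?_⟩
  have h := congrFun (congrFun (map_prod_cfGenOver (S := ℤ) l) 1) 1
  exact h.symm

lemma exists_denom_of_mem_reducedMonoid {A : Set ℕ} (h1 : 1 ∈ A) {q : ℕ}
    {M : Matrix (Fin 2) (Fin 2) (ZMod q)} (hM : M ∈ reducedMonoid A q) :
    ∃ d ∈ Denoms A, (d : ZMod q) = M 1 1 := by
  have key : ∃ l : List ℕ, (∀ a ∈ l, a ∈ A) ∧
      (l.map fun a : ℕ => cfGenOver (a : ZMod q)).prod = M := by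
    induction hM using Submonoid.closure_induction with
    | mem x hx =>
      obtain ⟨a, ha, rfl⟩ := hx
      exact ⟨[a], by simpa using ha, by simp⟩
    | one => exact ⟨[], by simp, by simp⟩
    | mul x y _ _ hx hy =>
      obtain ⟨l, hl, rfl⟩ := hx
      obtain ⟨m, hm, rfl⟩ := hy
      refine ⟨l ++ m, fun a ha => ?_, by simp⟩
      exact (List.mem_append.1 ha).elim (hl a) (hm a)
  obtain ⟨l, hl, rfl⟩ := key
  rcases eq_or_ne l [] with rfl | hne
  · exact ⟨_, prod_cfGenOver_mem_denoms (l := [1]) (by simp) (by simpa using h1),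
      by simp [cfGenOver]⟩
  · refine ⟨_, prod_cfGenOver_mem_denoms hne hl, ?_⟩
    exact congrFun (congrFun (map_prod_cfGenOver (S := ZMod q) l) 1) 1

lemma cfGenOver_one_mul_upperUnipotent {R : Type*} [CommRing R] (c : R) :
    cfGenOver 1 * upperUnipotent (c - 1) = cfGenOver c := by
  simp [cfGenOver, upperUnipotent]

lemma upperUnipotent_add {R : Type*} [CommRing R] (c d : R) :
    upperUnipotent (c + d) = upperUnipotent c * upperUnipotent d := by
  simp [upperUnipotent, add_comm]

lemma upperUnipotent_zero {R : Type*} [CommRing R] : upperUnipotent (0 : R) = 1 := by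
  simp [upperUnipotent, Matrix.one_fin_two]

lemma upperUnipotent_nsmul {R : Type*} [CommRing R] (n : ℕ) (c : R) :
    upperUnipotent (n * c) = upperUnipotent c ^ n := by
  induction n with
  | zero => simp [upperUnipotent_zero]
  | succ n ih => rw [pow_succ, ← ih, ← upperUnipotent_add]; congr 1; push_cast; ring

lemma exists_pow_mul_cfGenOver_one (q : ℕ) [NeZero q] :
    ∃ n : ℕ, cfGenOver (1 : ZMod q) ^ n * cfGenOver (1 : ZMod q) = 1 := by
  have hdet : IsUnit (cfGenOver (1 : ZMod q)) := by
    rw [Matrix.isUnit_iff_isUnit_det]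
    simp [cfGenOver, Matrix.det_fin_two]
  obtain ⟨u, hu⟩ := hdet
  obtain ⟨n, hn, hpow⟩ := (isOfFinOrder_of_finite u).exists_pow_eq_one
  refine ⟨n - 1, ?_⟩
  rw [← pow_succ, Nat.sub_add_cancel hn, ← hu, ← Units.val_pow_eq_pow_val, hpow, Units.val_one]

lemma cfGenOver_mem_reducedMonoid {A : Set ℕ} (h1 : 1 ∈ A) {q : ℕ} [NeZero q] {g : ℤ}
    (hg : AddSubgroup.closure ((fun a : ℕ => (a : ℤ) - 1) '' A) = AddSubgroup.closure {g})
    (k : ℤ) : cfGenOver ((1 + g * k : ℤ) : ZMod q) ∈ reducedMonoid A q := by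
  have hgen : ∀ a ∈ A, cfGenOver (a : ZMod q) ∈ reducedMonoid A q := fun a ha =>
    Submonoid.subset_closure ⟨a, ha, rfl⟩
  have hone : cfGenOver (1 : ZMod q) ∈ reducedMonoid A q := by simpa using hgen 1 h1
  let J : AddSubgroup ℤ :=
    { carrier := {k | upperUnipotent (k : ZMod q) ∈ reducedMonoid A q}
      zero_mem' := by simp [upperUnipotent_zero, one_mem]
      add_mem' := fun {a b} ha hb => by
        simp only [Set.mem_ofPred_eq, Int.cast_add, upperUnipotent_add] at *
        exact mul_mem ha hb
      neg_mem' := fun {a} ha => by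
        simp only [Set.mem_ofPred_eq] at *
        have h := pow_mem ha (q - 1)
        rw [← upperUnipotent_nsmul] at h
        have hq : 1 ≤ q := NeZero.one_le
        rw [Nat.cast_sub hq, ZMod.natCast_self] at h
        simpa using h }
  have hle : AddSubgroup.closure ((fun a : ℕ => (a : ℤ) - 1) '' A) ≤ J := by
    rw [AddSubgroup.closure_le]
    rintro _ ⟨a, ha, rfl⟩
    obtain ⟨n, hn⟩ := exists_pow_mul_cfGenOver_one q
    have h := mul_mem (pow_mem hone n) (hgen a ha)
    rw [← cfGenOver_one_mul_upperUnipotent (a : ZMod q), ← mul_assoc, hn, one_mul] at h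
    simpa [J] using h
  have hmem : g * k ∈ J := by
    apply hle
    rw [hg, AddSubgroup.mem_closure_singleton]
    exact ⟨k, by simp [mul_comm]⟩
  have h := mul_mem hone hmem
  rw [show ((g * k : ℤ) : ZMod q) = ((1 + g * k : ℤ) : ZMod q) - 1 by push_cast; ring,
    cfGenOver_one_mul_upperUnipotent] at h
  exact h

lemma cfGenOver_one_pow {R : Type*} [CommRing R] (n : ℕ) :
    (cfGenOver (1 : R) ^ n) 1 0 = (Nat.fib n : R) ∧
      (cfGenOver (1 : R) ^ n) 1 1 = (Nat.fib (n + 1) : R) := by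
  induction n with
  | zero => simp
  | succ n ih =>
    obtain ⟨h0, h1⟩ := ih
    rw [pow_succ]
    constructor
    · simp [Matrix.mul_apply, Fin.sum_univ_two, cfGenOver] at *
      exact h1
    · rw [Nat.fib_add_two]
      simp [Matrix.mul_apply, Fin.sum_univ_two, cfGenOver] at *
      rw [h0, h1]

lemma exists_isCoprime_add_mul {a : ℤ} {b : ℕ} (hb : b ≠ 0) (h : IsCoprime a b)
    {q : ℕ} (hq : q ≠ 0) : ∃ k : ℤ, IsCoprime (a + b * k) (q : ℤ) := by
  obtain ⟨p, hpq, hp, hmod⟩ := Nat.forall_exists_prime_gt_and_zmodEq q hb h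
  obtain ⟨k, hk⟩ := hmod.symm.dvd
  refine ⟨k, ?_⟩
  rw [← hk, add_sub_cancel, Nat.isCoprime_iff_coprime]
  exact hp.coprime_iff_not_dvd.2 fun hdvd =>
    absurd (Nat.le_of_dvd (Nat.pos_of_ne_zero hq) hdvd) (by omega)

/-- Every residue modulo `g ≤ 7`, apart possibly from `3`, is a Fibonacci number preceded by a
Fibonacci number coprime to `g`. -/
lemma fib_residue_small : ∀ g ∈ Finset.Icc 1 7, ∀ r ∈ Finset.range g, r % g = 3 % g ∨
    ∃ n ∈ Finset.range 24, Nat.Coprime (Nat.fib (n + 2)) g ∧ Nat.fib (n + 3) % g = r := by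
  decide +kernel

lemma hasNoLocalObstructions_of_small {A : Set ℕ} (h1 : 1 ∈ A) {g : ℕ} (hg0 : 0 < g)
    (hg7 : g ≤ 7)
    (hg : AddSubgroup.closure ((fun a : ℕ => (a : ℤ) - 1) '' A) = AddSubgroup.closure {(g : ℤ)}) :
    HasNoLocalObstructions A := by
  intro q hq r
  have : NeZero q := ⟨by omega⟩
  have hmem := cfGenOver_mem_reducedMonoid h1 (q := q) hg
  have hone : cfGenOver (1 : ZMod q) ∈ reducedMonoid A q := by simpa using hmem 0
  suffices h : ∃ M ∈ reducedMonoid A q, M 1 1 = r by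
    obtain ⟨M, hM, rfl⟩ := h
    exact exists_denom_of_mem_reducedMonoid h1 hM
  obtain ⟨s, rfl⟩ := ZMod.natCast_zmod_surjective r
  rcases fib_residue_small g (by simp; omega) (s % g) (by simpa using Nat.mod_lt _ hg0) with
    h3 | ⟨n, -, hcop, hfib⟩
  · have hdvd : (g : ℤ) ∣ s - 3 := by
      rw [Nat.mod_mod] at h3
      exact (Nat.modEq_iff_dvd.1 (show 3 ≡ s [MOD g] from h3.symm))
    obtain ⟨k, hk⟩ := hdvd
    refine ⟨_, mul_mem (mul_mem hone (hmem k)) hone, ?_⟩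
    rw [← hk]
    simp [cfGenOver]
    ring
  · have hc : IsCoprime (Nat.fib (n + 2) : ℤ) (g * Nat.fib (n + 1) : ℤ) :=
      IsCoprime.mul_right (Nat.isCoprime_iff_coprime.2 hcop)
        (Nat.isCoprime_iff_coprime.2 (Nat.fib_coprime_fib_succ (n + 1)).symm)
    have hb : g * Nat.fib (n + 1) ≠ 0 := (Nat.mul_pos hg0 (Nat.fib_pos.2 n.succ_pos)).ne'
    obtain ⟨k, hk⟩ := exists_isCoprime_add_mul hb (by rwa [Nat.cast_mul]) (NeZero.ne q)
    push_cast at hk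
    obtain ⟨v, w, hvw⟩ := hk
    set u : ℤ := Nat.fib (n + 2) + g * Nat.fib (n + 1) * k with hu
    have hdvd : (g : ℤ) ∣ s - Nat.fib (n + 3) :=
      Nat.modEq_iff_dvd.1 (show Nat.fib (n + 3) ≡ s [MOD g] from hfib)
    obtain ⟨t, ht⟩ := hdvd
    have hvu : (v : ZMod q) * (u : ZMod q) = 1 := by
      have := congrArg (Int.cast : ℤ → ZMod q) hvw
      simpa using this
    refine ⟨_, mul_mem (mul_mem (pow_mem hone n) (hmem k))
      (hmem (v * (t - Nat.fib (n + 1) * k))), ?_⟩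
    obtain ⟨e0, e1⟩ := cfGenOver_one_pow (R := ZMod q) n
    have e2 : (Nat.fib (n + 2) : ZMod q) = Nat.fib n + Nat.fib (n + 1) := by
      rw [Nat.fib_add_two]; push_cast; ring
    have e3 : (Nat.fib (n + 3) : ZMod q) = Nat.fib (n + 1) + Nat.fib (n + 2) := by
      rw [Nat.fib_add_two]; push_cast; ring
    have hs : (s : ZMod q) = Nat.fib (n + 3) + g * t := by
      have := congrArg (Int.cast : ℤ → ZMod q) ht
      push_cast at this
      rw [← this]; ring
    have hu' : (u : ZMod q) = Nat.fib (n + 2) + g * Nat.fib (n + 1) * k := by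
      rw [hu]; push_cast; ring
    have expand : ∀ (M : Matrix (Fin 2) (Fin 2) (ZMod q)) (c d : ZMod q),
        (M * cfGenOver c * cfGenOver d) 1 1 = M 1 1 + (M 1 0 + M 1 1 * c) * d := by
      intro M c d
      simp [Matrix.mul_apply, Fin.sum_univ_two, cfGenOver]
    rw [expand, e0, e1, hs, e3]
    push_cast
    have h2 : (Nat.fib n : ZMod q) + Nat.fib (n + 1) * (1 + g * k) = u := by
      rw [hu', e2]; ring
    rw [h2]
    linear_combination hu' + (g : ZMod q) * (t - Nat.fib (n + 1) * k) * hvu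

lemma mod_eq_one_of_closure_eq {A : Set ℕ} (hpos : ∀ a ∈ A, 0 < a) {g : ℕ}
    (hg : AddSubgroup.closure ((fun a : ℕ => (a : ℤ) - 1) '' A) = AddSubgroup.closure {(g : ℤ)})
    {a : ℕ} (ha : a ∈ A) : ∃ n : ℕ, a = g * n + 1 := by
  have hmem : (a : ℤ) - 1 ∈ AddSubgroup.closure {(g : ℤ)} :=
    hg ▸ AddSubgroup.subset_closure ⟨a, ha, rfl⟩
  rw [AddSubgroup.mem_closure_singleton] at hmem
  obtain ⟨n, hn⟩ := hmem
  have hdvd : (g : ℤ) ∣ ((a - 1 : ℕ) : ℤ) := ⟨n, by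
    rw [Nat.cast_sub (hpos a ha)]; simp at hn ⊢; linarith⟩
  obtain ⟨m, hm⟩ := Int.natCast_dvd_natCast.1 hdvd
  exact ⟨m, by have := hpos a ha; omega⟩

/-- An alphabet containing `1` with local obstructions is contained in `gℕ + 1` for some
`g ≥ 8`. -/
lemma exists_modulus_of_obstruction {A : Set ℕ} (hpos : ∀ a ∈ A, 0 < a) (h1 : 1 ∈ A)
    (hobs : ¬ HasNoLocalObstructions A) :
    ∃ g : ℕ, 8 ≤ g ∧ ∀ a ∈ A, ∃ n : ℕ, a = g * n + 1 := by
  obtain ⟨g', hg'⟩ := Int.subgroup_cyclic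
    (AddSubgroup.closure ((fun a : ℕ => (a : ℤ) - 1) '' A))
  have hg : AddSubgroup.closure ((fun a : ℕ => (a : ℤ) - 1) '' A) =
      AddSubgroup.closure {(g'.natAbs : ℤ)} := by
    rw [hg', ← AddSubgroup.zmultiples_eq_closure, ← AddSubgroup.zmultiples_eq_closure,
      Int.zmultiples_natAbs]
  rcases Nat.lt_or_ge g'.natAbs 8 with hlt | hge
  · rcases Nat.eq_zero_or_pos g'.natAbs with h0 | h0
    · refine ⟨8, le_rfl, fun a ha => ⟨0, ?_⟩⟩
      obtain ⟨n, hn⟩ := mod_eq_one_of_closure_eq hpos hg ha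
      rw [h0] at hn
      omega
    · exact absurd (hasNoLocalObstructions_of_small h1 h0 (by omega) hg) hobs
  · exact ⟨_, hge, fun a ha => mod_eq_one_of_closure_eq hpos hg ha⟩

end LocalObstructions

section ContinuedFractionOrbits

/-- `u` is the orbit under the Gauss map of the continued fraction with partial quotients `a`. -/
structure IsGaussOrbit (a : ℕ → ℕ) (u : ℕ → ℝ) : Prop where
  pos : ∀ n, 0 < u n
  lt_one : ∀ n, u n < 1
  mul_eq : ∀ n, u n * (a n + u (n + 1)) = 1

lemma IsGaussOrbit.shift {a : ℕ → ℕ} {u : ℕ → ℝ} (h : IsGaussOrbit a u) :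
    IsGaussOrbit (fun n => a (n + 1)) (fun n => u (n + 1)) :=
  ⟨fun n => h.pos _, fun n => h.lt_one _, fun n => h.mul_eq _⟩

lemma exists_partial_orbit (N : ℕ) : ∀ a : ℕ → ℕ, (∀ n, 0 < a n) →
    ∃ u : ℕ → ℝ, (∀ n, u n ∈ Set.Icc (0 : ℝ) 1) ∧ ∀ n < N, u n * (a n + u (n + 1)) = 1 := by
  induction N with
  | zero => exact fun a _ => ⟨fun _ => 0, by simp, by simp⟩
  | succ N ih =>
    intro a ha
    obtain ⟨u, hu, hrec⟩ := ih (fun n => a (n + 1)) fun n => ha _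
    have ha0 : (1 : ℝ) ≤ a 0 := by exact_mod_cast ha 0
    have hden : (1 : ℝ) ≤ a 0 + u 0 := by linarith [(hu 0).1]
    refine ⟨fun n => Nat.casesOn n (a 0 + u 0 : ℝ)⁻¹ u, ?_, ?_⟩
    · rintro (_ | n)
      · exact ⟨inv_nonneg.2 (by linarith), inv_le_one_of_one_le₀ hden⟩
      · exact hu n
    · rintro (_ | n) hn
      · exact inv_mul_cancel₀ (zero_lt_one.trans_le hden).ne'
      · exact hrec n (by omega)

lemma exists_isGaussOrbit (a : ℕ → ℕ) (ha : ∀ n, 0 < a n) : ∃ u, IsGaussOrbit a u := by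
  let Z : ℕ → Set (ℕ → ℝ) := fun N =>
    Set.univ.pi (fun _ => Set.Icc (0 : ℝ) 1) ∩ {u | ∀ n < N, u n * (a n + u (n + 1)) = 1}
  have hclosed : ∀ N, IsClosed {u : ℕ → ℝ | ∀ n < N, u n * (a n + u (n + 1)) = 1} := by
    intro N
    simp only [Set.ofPred_forall]
    exact isClosed_iInter fun n => isClosed_iInter fun _ =>
      isClosed_eq (by fun_prop) continuous_const
  have hcpt : IsCompact (Set.univ.pi (fun _ : ℕ => Set.Icc (0 : ℝ) 1)) :=
    isCompact_univ_pi fun _ => isCompact_Icc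
  obtain ⟨u, hu⟩ := IsCompact.nonempty_iInter_of_sequence_nonempty_isCompact_isClosed Z
    (fun N u hu => ⟨hu.1, fun n hn => hu.2 n (by omega)⟩)
    (fun N => by
      obtain ⟨u, hu, hrec⟩ := exists_partial_orbit N a ha
      exact ⟨u, fun n _ => hu n, hrec⟩)
    (hcpt.inter_right (hclosed 0))
    (fun N => hcpt.isClosed.inter (hclosed N))
  rw [Set.mem_iInter] at hu
  have hmem : ∀ n, u n ∈ Set.Icc (0 : ℝ) 1 := fun n => (hu 0).1 n trivial
  have hrec : ∀ n, u n * (a n + u (n + 1)) = 1 := fun n => (hu (n + 1)).2 n (by omega)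
  have hpos : ∀ n, 0 < u n := fun n => lt_of_le_of_ne (hmem n).1 fun h0 => by
    have := hrec n
    rw [← h0] at this
    simp at this
  refine ⟨u, hpos, fun n => ?_, hrec⟩
  have h1 : (1 : ℝ) ≤ a n := by exact_mod_cast ha n
  nlinarith [hrec n, hpos n, hpos (n + 1), mul_pos (hpos n) (hpos (n + 1))]

namespace IsGaussOrbit

variable {a b : ℕ → ℕ} {u v : ℕ → ℝ}

lemma inv_eq (h : IsGaussOrbit a u) (n : ℕ) : (u n)⁻¹ = a n + u (n + 1) :=
  inv_eq_of_mul_eq_one_right (h.mul_eq n)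

lemma floor_inv (h : IsGaussOrbit a u) (n : ℕ) : ⌊(u n)⁻¹⌋ = (a n : ℤ) := by
  rw [h.inv_eq, Int.floor_eq_iff]
  have := h.pos (n + 1)
  have := h.lt_one (n + 1)
  push_cast
  constructor <;> linarith

lemma gaussMap_eq (h : IsGaussOrbit a u) (n : ℕ) : gaussMap (u n) = u (n + 1) := by
  rw [gaussMap, Int.fract, h.floor_inv, h.inv_eq]
  push_cast
  ring

lemma iterate_gaussMap (h : IsGaussOrbit a u) (n : ℕ) : gaussMap^[n] (u 0) = u n := by
  induction n with
  | zero => rfl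
  | succ n ih => rw [Function.iterate_succ_apply', ih, h.gaussMap_eq]

lemma ne_div (q : ℕ) : ∀ {a : ℕ → ℕ} {u : ℕ → ℝ}, IsGaussOrbit a u →
    ∀ p : ℕ, u 0 ≠ (p : ℝ) / q := by
  induction q using Nat.strong_induction_on with
  | _ q ih =>
    intro a u h p hp
    have h0 := h.pos 0
    have h1 := h.lt_one 0
    have h2 := h.pos 1
    have hq : 0 < q := by
      rcases Nat.eq_zero_or_pos q with rfl | hq
      · simp [hp] at h0
      · exact hq
    have hq' : (0 : ℝ) < q := by exact_mod_cast hq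
    have hp0 : (0 : ℝ) < p := by
      rw [hp] at h0
      exact (div_pos_iff_of_pos_right hq').1 h0
    have hpq : p < q := by
      rw [hp, div_lt_one hq'] at h1
      exact_mod_cast h1
    have hmul := h.mul_eq 0
    rw [hp] at hmul
    field_simp at hmul
    simp only [zero_add] at hmul
    have hle : a 0 * p ≤ q := by
      have : (a 0 * p : ℝ) ≤ q := by nlinarith
      exact_mod_cast this
    refine ih p hpq h.shift (q - a 0 * p) ?_
    rw [Nat.cast_sub hle]
    push_cast
    field_simp
    linarith

lemma irrational (h : IsGaussOrbit a u) : Irrational (u 0) := by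
  rintro ⟨r, hr⟩
  have hr0 : 0 < r := by
    have := h.pos 0
    rw [← hr] at this
    exact_mod_cast this
  refine ne_div r.den h r.num.toNat ?_
  have hnum : ((r.num.toNat : ℤ) : ℝ) = (r.num : ℝ) := by
    rw [Int.toNat_of_nonneg (Rat.num_nonneg.2 hr0.le)]
  rw [← hr, ← Int.cast_natCast (R := ℝ) r.num.toNat, hnum]
  exact Rat.cast_def r

lemma mem_cfCantorSet (h : IsGaussOrbit a u) {A : Set ℕ} (hA : ∀ n, a n ∈ A) :
    u 0 ∈ cfCantorSet A := by
  refine ⟨h.irrational, ⟨h.pos 0, h.lt_one 0⟩, fun n => ⟨a n, hA n, ?_⟩⟩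
  rw [partialQuot, h.iterate_gaussMap, h.floor_inv]

lemma one_le (h : IsGaussOrbit a u) (n : ℕ) : 1 ≤ a n := by
  by_contra hlt
  have h0 : a n = 0 := by omega
  have := h.mul_eq n
  rw [h0] at this
  simp only [Nat.cast_zero, zero_add] at this
  nlinarith [h.pos n, h.lt_one n, h.pos (n + 1), h.lt_one (n + 1)]

lemma mul_succ_le_half (h : IsGaussOrbit a u) (n : ℕ) : u n * u (n + 1) ≤ 1 / 2 := by
  have h1 : (1 : ℝ) ≤ a n := by exact_mod_cast h.one_le n
  nlinarith [h.mul_eq n, h.pos n, h.pos (n + 1), h.lt_one (n + 1),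
    mul_le_mul_of_nonneg_left h1 (h.pos n).le]

lemma prod_nonneg (h : IsGaussOrbit a u) (n : ℕ) : 0 ≤ ∏ i ∈ Finset.range n, u i :=
  Finset.prod_nonneg fun i _ => (h.pos i).le

lemma prod_pos (h : IsGaussOrbit a u) (n : ℕ) : 0 < ∏ i ∈ Finset.range n, u i :=
  Finset.prod_pos fun i _ => h.pos i

lemma prod_range_two_mul_le (h : IsGaussOrbit a u) (n : ℕ) :
    ∏ i ∈ Finset.range (2 * n), u i ≤ (1 / 2) ^ n := by
  induction n with
  | zero => simp
  | succ n ih =>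
    rw [show 2 * (n + 1) = 2 * n + 1 + 1 by ring, Finset.prod_range_succ, Finset.prod_range_succ,
      pow_succ, mul_assoc]
    exact mul_le_mul ih (h.mul_succ_le_half _) (mul_pos (h.pos _) (h.pos _)).le (by positivity)

lemma abs_sub_eq (hu : IsGaussOrbit a u) (hv : IsGaussOrbit b v) (n : ℕ)
    (hab : ∀ i < n, a i = b i) :
    |u 0 - v 0| =
      (∏ i ∈ Finset.range n, u i) * (∏ i ∈ Finset.range n, v i) * |u n - v n| := by
  induction n with
  | zero => simp
  | succ n ih =>
    rw [ih fun i hi => hab i (by omega), Finset.prod_range_succ, Finset.prod_range_succ]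
    have key : u n - v n = -(u n * v n * (u (n + 1) - v (n + 1))) := by
      have h1 := hu.mul_eq n
      have h2 := hv.mul_eq n
      rw [hab n (by omega)] at h1
      linear_combination v n * h1 - u n * h2
    rw [key, abs_neg, abs_mul, abs_of_pos (mul_pos (hu.pos n) (hv.pos n))]
    ring

lemma eq_of_digits_eq (hu : IsGaussOrbit a u) (hv : IsGaussOrbit a v) : u 0 = v 0 := by
  have hb : ∀ n : ℕ, |u 0 - v 0| ≤ (1 / 2 : ℝ) ^ n := by
    intro n
    rw [hu.abs_sub_eq hv (2 * n) fun _ _ => rfl]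
    have h1 := hu.prod_range_two_mul_le n
    have h2 : ∏ i ∈ Finset.range (2 * n), v i ≤ 1 :=
      Finset.prod_le_one (fun i _ => (hv.pos i).le) fun i _ => (hv.lt_one i).le
    have h3 : |u (2 * n) - v (2 * n)| ≤ 1 := by
      rw [abs_le]
      constructor <;>
        linarith [hu.pos (2 * n), hu.lt_one (2 * n), hv.pos (2 * n), hv.lt_one (2 * n)]
    calc _ ≤ (1 / 2 : ℝ) ^ n * 1 * 1 := by
          gcongr
          exact hv.prod_nonneg _
      _ = _ := by ring
  have hlim : Filter.Tendsto (fun n : ℕ => (1 / 2 : ℝ) ^ n) Filter.atTop (nhds 0) :=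
    tendsto_pow_atTop_nhds_zero_of_lt_one (by norm_num) (by norm_num)
  have h0 : |u 0 - v 0| ≤ 0 := ge_of_tendsto' hlim hb
  exact sub_eq_zero.1 (abs_nonpos_iff.1 h0)

/-- Enlarging partial quotients shrinks the contraction ratios, up to a factor `2`. -/
lemma prod_le_two_mul_prod (n : ℕ) : ∀ {a b : ℕ → ℕ} {u v : ℕ → ℝ}, IsGaussOrbit a u →
    IsGaussOrbit b v → (∀ i, a i ≤ b i) →
    ∏ i ∈ Finset.range n, v i ≤ 2 * ∏ i ∈ Finset.range n, u i := by
  suffices H : ∀ {a b : ℕ → ℕ} {u v : ℕ → ℝ}, IsGaussOrbit a u →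
      IsGaussOrbit b v → (∀ i, a i ≤ b i) →
      ∏ i ∈ Finset.range n, (u i)⁻¹ ≤ 2 * ∏ i ∈ Finset.range n, (v i)⁻¹ by
    intro a b u v hu hv hab
    have := H hu hv hab
    rw [Finset.prod_inv_distrib, Finset.prod_inv_distrib] at this
    have hpu := hu.prod_pos n
    have hpv := hv.prod_pos n
    field_simp at this
    linarith
  induction n using Nat.twoStepInduction with
  | zero => intros; norm_num
  | one =>
    intro a b u v hu hv hab
    simp only [Finset.prod_range_one, hu.inv_eq, hv.inv_eq]
    have h1 : (a 0 : ℝ) ≤ b 0 := by exact_mod_cast hab 0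
    have h2 : (1 : ℝ) ≤ a 0 := by exact_mod_cast hu.one_le 0
    linarith [hu.lt_one (0 + 1), hv.pos (0 + 1)]
  | more n ih1 ih2 =>
    have expand : ∀ {a : ℕ → ℕ} {u : ℕ → ℝ}, IsGaussOrbit a u →
        ∏ i ∈ Finset.range (n + 2), (u i)⁻¹ =
          a 0 * ∏ i ∈ Finset.range (n + 1), (u (i + 1))⁻¹ +
            ∏ i ∈ Finset.range n, (u (i + 1 + 1))⁻¹ := by
      intro a u hu
      rw [Finset.prod_range_succ', hu.inv_eq 0, Finset.prod_range_succ' _ n]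
      have := (hu.pos 1).ne'
      simp only [zero_add]
      field_simp
    intro a b u v hu hv hab
    rw [expand hu, expand hv]
    have e1 := ih1 hu.shift.shift hv.shift.shift fun i => hab _
    have e2 := ih2 hu.shift hv.shift fun i => hab _
    have h1 : (a 0 : ℝ) ≤ b 0 := by exact_mod_cast hab 0
    have hnn := hv.shift.prod_pos (n + 1)
    have hnn' : 0 ≤ ∏ i ∈ Finset.range (n + 1), (v (i + 1))⁻¹ :=
      Finset.prod_nonneg fun i _ => (inv_pos.2 (hv.pos _)).le
    have e3 := mul_le_mul_of_nonneg_left e2 (Nat.cast_nonneg (α := ℝ) (a 0))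
    have e4 := mul_le_mul_of_nonneg_right h1 hnn'
    linarith

end IsGaussOrbit

lemma exists_isGaussOrbit_of_mem {A : Set ℕ} {y : ℝ} (hy : y ∈ cfCantorSet A) :
    ∃ (b : ℕ → ℕ) (v : ℕ → ℝ), IsGaussOrbit b v ∧ v 0 = y ∧ ∀ n, b n ∈ A := by
  obtain ⟨hirr, hIoo, hdig⟩ := hy
  choose b hbA hb using hdig
  have horb : ∀ n, Irrational (gaussMap^[n] y) ∧ gaussMap^[n] y ∈ Set.Ioo (0 : ℝ) 1 := by
    intro n
    induction n with
    | zero => exact ⟨hirr, hIoo⟩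
    | succ n ih =>
      rw [Function.iterate_succ_apply']
      have hi : Irrational (gaussMap (gaussMap^[n] y)) := by
        rw [gaussMap, Int.fract]
        exact ih.1.inv.sub_intCast _
      exact ⟨hi, lt_of_le_of_ne (Int.fract_nonneg _) hi.ne_zero.symm, Int.fract_lt_one _⟩
  refine ⟨b, fun n => gaussMap^[n] y, ⟨fun n => (horb n).2.1, fun n => (horb n).2.2, fun n => ?_⟩,
    rfl, hbA⟩
  have hfl := hb n
  rw [partialQuot] at hfl
  have hne := (horb n).2.1.ne'
  rw [Function.iterate_succ_apply', gaussMap, Int.fract, hfl]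
  push_cast
  rw [add_sub_cancel, mul_inv_cancel₀ hne]

lemma abs_sub_le_of_digits_ne {g m m' : ℝ} {x x' s s' t t' : ℝ} (hg : 8 ≤ g)
    (hm : 0 ≤ m) (hm' : 0 ≤ m') (hmm : 1 ≤ |m - m'|)
    (hx : 0 < x) (hx' : 0 < x')
    (hs : s ∈ Set.Ioo (0 : ℝ) 1) (hs' : s' ∈ Set.Ioo (0 : ℝ) 1)
    (ht : t ∈ Set.Ioo (0 : ℝ) 1) (ht' : t' ∈ Set.Ioo (0 : ℝ) 1)
    {y y' : ℝ} (hy : 0 < y) (hy' : 0 < y')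
    (ex : x * (8 * m + 1 + s) = 1) (ex' : x' * (8 * m' + 1 + s') = 1)
    (ey : y * (g * m + 1 + t) = 1) (ey' : y' * (g * m' + 1 + t') = 1) :
    |y - y'| ≤ g * |x - x'| := by
  obtain ⟨hs0, hs1⟩ := hs
  obtain ⟨hs0', hs1'⟩ := hs'
  obtain ⟨ht0, ht1⟩ := ht
  obtain ⟨ht0', ht1'⟩ := ht'
  have hyx : ∀ {m s t x y : ℝ}, 0 ≤ m → s < 1 → 0 < t → 0 < x → 0 < y →
      x * (8 * m + 1 + s) = 1 → y * (g * m + 1 + t) = 1 → y ≤ 2 * x := by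
    intro m s t x y hm hs ht hx hy ex ey
    have h : 8 * m + 1 + s ≤ 2 * (g * m + 1 + t) := by nlinarith
    have h1 := mul_le_mul_of_nonneg_left h (mul_pos hx hy).le
    linear_combination h1 - y * ex + 2 * x * ey
  have e1 : y - y' = y * y' * (g * (m' - m) + (t' - t)) := by
    linear_combination y' * ey - y * ey'
  have e2 : x - x' = x * x' * (8 * (m' - m) + (s' - s)) := by
    linear_combination x' * ex - x * ex'
  rw [abs_sub_comm m m'] at hmm
  have b1 : |g * (m' - m) + (t' - t)| ≤ (g + 1) * |m' - m| := by
    have h1 : |t' - t| ≤ 1 := by rw [abs_le]; constructor <;> linarith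
    have h2 := abs_add_le (g * (m' - m)) (t' - t)
    rw [abs_mul, abs_of_nonneg (by linarith : 0 ≤ g)] at h2
    linarith
  have b2 : 7 * |m' - m| ≤ |8 * (m' - m) + (s' - s)| := by
    have h1 : |s' - s| ≤ 1 := by rw [abs_le]; constructor <;> linarith
    have h2 := abs_sub_abs_le_abs_add (8 * (m' - m)) (s' - s)
    rw [abs_mul, abs_of_nonneg (by norm_num : (0 : ℝ) ≤ 8)] at h2
    linarith
  rw [e1, e2, abs_mul, abs_mul (x * x'), abs_of_pos (mul_pos hy hy'), abs_of_pos (mul_pos hx hx')]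
  have hg1 : (g + 1) * |m' - m| ≤ g / 4 * |8 * (m' - m) + (s' - s)| := by
    nlinarith [abs_nonneg (m' - m)]
  calc _ ≤ (2 * x) * (2 * x') * (g / 4 * |8 * (m' - m) + (s' - s)|) := by
        gcongr
        · exact hyx hm hs1 ht0 hx hy ex ey
        · exact hyx hm' hs1' ht0' hx' hy' ex' ey'
        · exact b1.trans hg1
    _ = _ := by ring

/-- Replacing the alphabet `8ℕ + 1` by `gℕ + 1` with `g ≥ 8` does not increase the dimension. -/
lemma dimH_cfCantorSet_le_oct {A : Set ℕ} {g : ℕ} (hg : 8 ≤ g)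
    (hA : ∀ a ∈ A, ∃ n : ℕ, a = g * n + 1) :
    dimH (cfCantorSet A) ≤ dimH (cfCantorSet octAlphabet) := by
  have hex : ∀ y : cfCantorSet A, ∃ (m : ℕ → ℕ) (v : ℕ → ℝ),
      IsGaussOrbit (fun n => g * m n + 1) v ∧ v 0 = y := by
    rintro ⟨y, hy⟩
    obtain ⟨b, v, hv, h0, hb⟩ := exists_isGaussOrbit_of_mem hy
    choose m hm using fun n => hA _ (hb n)
    obtain rfl : b = fun n => g * m n + 1 := funext hm
    exact ⟨m, v, hv, h0⟩
  choose m v hv hv0 using hex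
  choose U hU using fun m : ℕ → ℕ => exists_isGaussOrbit (fun n => 8 * m n + 1) (by simp)
  let ψ : cfCantorSet A → ℝ := fun y => U (m y) 0
  have hanti : AntilipschitzWith (4 * g) ψ := by
    refine AntilipschitzWith.of_le_mul_dist fun y z => ?_
    rw [Subtype.dist_eq, Real.dist_eq, Real.dist_eq, ← hv0 y, ← hv0 z]
    by_cases hmm : m y = m z
    · have h := hv z
      rw [← hmm] at h
      rw [(hv y).eq_of_digits_eq h, sub_self, abs_zero]
      positivity
    · have hne : ∃ n, m y n ≠ m z n := by
        by_contra! hall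
        exact hmm (funext hall)
      classical
      have hspec := Nat.find_spec hne
      have hmin : ∀ i < Nat.find hne, m y i = m z i := fun i hi => by
        simpa using Nat.find_min hne hi
      set n := Nat.find hne
      have hle : ∀ (k : ℕ → ℕ) i, 8 * k i + 1 ≤ g * k i + 1 := fun k i => by gcongr
      rw [(hv y).abs_sub_eq (hv z) n fun i hi => by simp only [hmin i hi]]
      rw [(hU (m y)).abs_sub_eq (hU (m z)) n fun i hi => by simp only [hmin i hi]]
      have p1 := IsGaussOrbit.prod_le_two_mul_prod n (hU (m y)) (hv y) (hle _)
      have p2 := IsGaussOrbit.prod_le_two_mul_prod n (hU (m z)) (hv z) (hle _)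
      have hstep : |v y n - v z n| ≤ g * |U (m y) n - U (m z) n| := by
        have e1 := (hU (m y)).mul_eq n
        have e2 := (hU (m z)).mul_eq n
        have e3 := (hv y).mul_eq n
        have e4 := (hv z).mul_eq n
        push_cast at e1 e2 e3 e4
        refine abs_sub_le_of_digits_ne (by exact_mod_cast hg) (Nat.cast_nonneg (m y n))
          (Nat.cast_nonneg (m z n)) ?_ ((hU _).pos n) ((hU _).pos n)
          ⟨(hU _).pos _, (hU _).lt_one _⟩ ⟨(hU _).pos _, (hU _).lt_one _⟩
          ⟨(hv _).pos _, (hv _).lt_one _⟩ ⟨(hv _).pos _, (hv _).lt_one _⟩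
          ((hv _).pos n) ((hv _).pos n) e1 e2 e3 e4
        have : (1 : ℤ) ≤ |(m y n : ℤ) - m z n| := Int.one_le_abs (by omega)
        exact_mod_cast this
      have q1 := (hU (m y)).prod_nonneg n
      have q2 := (hU (m z)).prod_nonneg n
      calc _ ≤ (2 * ∏ i ∈ Finset.range n, U (m y) i) * (2 * ∏ i ∈ Finset.range n, U (m z) i) *
            (g * |U (m y) n - U (m z) n|) := by
              gcongr
              exact (hv z).prod_nonneg n
        _ = _ := by push_cast; ring
  have himg : ψ '' Set.univ ⊆ cfCantorSet octAlphabet := by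
    rintro _ ⟨y, -, rfl⟩
    exact (hU (m y)).mem_cfCantorSet fun n => ⟨by omega, by omega⟩
  have hval : dimH (cfCantorSet A) = dimH (Set.univ : Set (cfCantorSet A)) := by
    rw [← (isometry_subtype_coe (s := cfCantorSet A)).dimH_image, Set.image_univ, Subtype.range_coe]
  rw [hval]
  exact (hanti.le_dimH_image _).trans (dimH_mono himg)

end ContinuedFractionOrbits

/-- Among all alphabets containing 1 that have local obstructions, `A_oct` has
the largest Hausdorff dimension. -/
theorem octAlphabet_maximal_with_local_obstructions (A : Set ℕ)
    (hne : A.Nonempty) (hpos : ∀ a ∈ A, 0 < a) (h1 : 1 ∈ A)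
    (hobs : ¬ HasNoLocalObstructions A) :
    dimH (cfCantorSet A) ≤ dimH (cfCantorSet octAlphabet) := by
  obtain ⟨g, hg, hA⟩ := exists_modulus_of_obstruction hpos h1 hobs
  exact dimH_cfCantorSet_le_oct hg hA
end
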